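/- arXiv:2403.18141 — 4 statements merged into one kernel-verified Lean document; each statement's English description precedes it below -/
import Mathlib

section
/- Let R > 1, let t be an R-summable sequence of complex numbers, and let t̄ := (conj(t_1), conj(t_2), ...). Let X = {x_1, ..., x_m} ⊂ ℤ' be a finite set of half-integers. Then the family (|s_λ(t)|² · 1_{X ⊆ S_0(λ)})_λ, indexed by all Young diagrams λ, is summable, and Σ_λ |s_λ(t)|² · 1_{X ⊆ S_0(λ)} = exp(Σ_{n≥1} n |t_n|²) · det(K_{t,t̄}(x_i, x_j))_{i,j=1}^m. Equivalently, under the Schur measure λ ↦ Z_{t,t̄}^{−1} |s_λ(t)|², the probability that X ⊆ S_0(λ) equals det(K_{t,t̄}(x_i,x_j))_{i,j=1}^m. -/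
open scoped BigOperators

noncomputable section

/-- `t : ℕ → ℂ` encodes the sequence `(t_1, t_2, …)` via `t n = t_{n+1}`.
`t` is `R`-summable if `∑_{n ≥ 1} |t_n| R^n < ∞`. -/
def RSummable (R : ℝ) (t : ℕ → ℂ) : Prop :=
  Summable fun n : ℕ => ‖t n‖ * R ^ (n + 1)

/-- `γ(z,t) = exp (∑_{n ≥ 1} t_n z^n)`. -/
def gammaFn (z : ℂ) (t : ℕ → ℂ) : ℂ :=
  Complex.exp (∑' n : ℕ, t n * z ^ (n + 1))

/-- `J(z;t,t') = exp (∑_{n ≥ 1} (t_n z^n − t'_n z^{-n}))`. -/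
def Jfun (z : ℂ) (t t' : ℕ → ℂ) : ℂ :=
  Complex.exp (∑' n : ℕ, (t n * z ^ (n + 1) - t' n * z⁻¹ ^ (n + 1)))

/-- `J_k(t,t')`, the `k`-th Laurent coefficient of `z ↦ J(z;t,t')`:
`J_k(t,t') = (1/(2π)) ∫ ₀^{2π} J(e^{iθ};t,t') e^{-ikθ} dθ`. -/
def Jcoef (t t' : ℕ → ℂ) (k : ℤ) : ℂ :=
  (2 * Real.pi : ℂ)⁻¹ *
    ∫ θ in (0:ℝ)..(2 * Real.pi),
      Jfun (Complex.exp (θ * Complex.I)) t t' * Complex.exp (-(k : ℂ) * θ * Complex.I)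

/-- The half-integer `a + 1/2 ∈ ℤ'` is encoded by the integer `a : ℤ`.
The kernel `K_{t,t',σ}(x,y) = ∑_{k ∈ ℤ'} σ(k) J_{x+k}(t,t') J_{-y-k}(-t,-t')`:
for `x = a + 1/2`, `y = b + 1/2`, `k = c + 1/2` one has `x + k = a + c + 1` and
`-y - k = -(b + c + 1)`. -/
def Kker (t t' : ℕ → ℂ) (σ : ℤ → ℝ) (a b : ℤ) : ℂ :=
  ∑' c : ℤ, (σ c : ℂ) * Jcoef t t' (a + c + 1) * Jcoef (-t) (-t') (-(b + c + 1))

/-- The indicator `1_{ℤ'_{>0}}` of the positive half-integers: `c + 1/2 > 0 ↔ 0 ≤ c`. -/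
def posInd : ℤ → ℝ := fun c => if 0 ≤ c then 1 else 0

/-- `Z_{t,t'} = exp (∑_{n ≥ 1} n t_n t'_n)`. -/
def Zconst (t t' : ℕ → ℂ) : ℂ :=
  Complex.exp (∑' n : ℕ, (n + 1 : ℂ) * t n * t' n)

/-- The Fredholm series `D_n` of a kernel `K` on `ℓ²(ℤ' ∩ (n,∞))`; the half-integer
`a + 1/2` belongs to `(n,∞)` iff `n ≤ a`. -/
def fredholmSeries (K : ℤ → ℤ → ℂ) (n : ℤ) : ℂ :=
  ∑' m : ℕ, ((-1 : ℂ) ^ m / m.factorial) *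
    ∑' x : Fin m → {a : ℤ // n ≤ a},
      Matrix.det (Matrix.of fun i j : Fin m => K (x i) (x j))

/-- Absolute convergence of the Fredholm series of `K` on `ℓ²(ℤ' ∩ (n,∞))`. -/
def FredholmAbsConv (K : ℤ → ℤ → ℂ) (n : ℤ) : Prop :=
  (∀ m : ℕ, Summable fun x : Fin m → {a : ℤ // n ≤ a} =>
      ‖Matrix.det (Matrix.of fun i j : Fin m => K (x i) (x j))‖) ∧
    Summable fun m : ℕ => (m.factorial : ℝ)⁻¹ *
      ∑' x : Fin m → {a : ℤ // n ≤ a},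
        ‖Matrix.det (Matrix.of fun i j : Fin m => K (x i) (x j))‖

/-- `τ_n(t,t';σ) = Z_{t,t'} · D_n(t,t';σ)`. -/
def tauFn (σ : ℤ → ℝ) (t t' : ℕ → ℂ) (n : ℤ) : ℂ :=
  Zconst t t' * fredholmSeries (Kker t t' σ) n

/-- `{z} = (z, z²/2, z³/3, …)`. -/
def chargeSeq (z : ℂ) : ℕ → ℂ := fun n => z ^ (n + 1) / (n + 1)

/-- `h_k(t)`: the Taylor coefficients of `γ(·,t)`, with `h_k(t) = 0` for `k < 0`. -/
def hcoef (t : ℕ → ℂ) (k : ℤ) : ℂ :=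
  if k < 0 then 0 else
    (2 * Real.pi : ℂ)⁻¹ *
      ∫ θ in (0:ℝ)..(2 * Real.pi),
        gammaFn (Complex.exp (θ * Complex.I)) t * Complex.exp (-(k : ℂ) * θ * Complex.I)

/-- Young diagrams (partitions): `part i` is the `(i+1)`-st part `λ_{i+1}`. -/
structure Partition' where
  part : ℕ → ℕ
  antitone : Antitone part
  ev_zero : ∃ N, ∀ i ≥ N, part i = 0

/-- The number `ℓ(λ)` of nonzero parts. -/
def Partition'.len (lam : Partition') : ℕ := sInf {N | lam.part N = 0}

/-- `s_λ(t) = det (h_{λ_i − i + j}(t))_{i,j = 1}^{ℓ(λ)}` (Jacobi–Trudi). -/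
def schurPoly (t : ℕ → ℂ) (lam : Partition') : ℂ :=
  Matrix.det (Matrix.of fun i j : Fin lam.len =>
    hcoef t ((lam.part i : ℤ) + (j : ℤ) - (i : ℤ)))

/-- `S_0(λ) = {λ_i − i + 1/2 : i ≥ 1} ⊂ ℤ'` in integer coordinates
(`a : ℤ` encodes the half-integer `a + 1/2`). -/
def S0 (lam : Partition') : Set ℤ := {a : ℤ | ∃ i : ℕ, a = (lam.part i : ℤ) - (i + 1)}

/-- The multiplicative functional `∏_{x ∈ S_0(λ)} (1 − σ(x − n))
  = ∏_{i ≥ 1} (1 − σ(λ_i − i + 1/2 − n))`. -/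
def multFunc (σ : ℤ → ℝ) (n : ℤ) (lam : Partition') : ℝ :=
  ∏' i : ℕ, (1 - σ ((lam.part i : ℤ) - (i + 1) - n))

theorem summable_prod_pi {ι : Type*} {N : ℕ} (f : Fin N → ι → ℂ) (hf : ∀ i, Summable (f i)) :
    Summable (fun s : Fin N → ι => ∏ i, f i (s i)) ∧
      ∑' s : Fin N → ι, ∏ i, f i (s i) = ∏ i, ∑' k, f i k := by
  induction N with
  | zero => exact ⟨(hasSum_fintype _).summable, by simp⟩
  | succ n ih =>
    obtain ⟨h1, h2⟩ := ih (fun i => f i.succ) fun i => hf _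
    have hs : Summable fun p : ι × (Fin n → ι) => f 0 p.1 * ∏ i, f (Fin.succ i) (p.2 i) :=
      summable_mul_of_summable_norm (f := f 0)
        (g := fun q : Fin n → ι => ∏ i, f (Fin.succ i) (q i)) (hf 0).norm h1.norm
    have he : (fun s : Fin (n + 1) → ι => ∏ i, f i (s i)) ∘ (Fin.consEquiv fun _ => ι)
        = fun p : ι × (Fin n → ι) => f 0 p.1 * ∏ i, f (Fin.succ i) (p.2 i) := by
      funext p
      simp only [Function.comp_apply, Fin.prod_univ_succ, Fin.consEquiv_apply, Fin.cons_zero,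
        Fin.cons_succ]
    constructor
    · rw [← (Fin.consEquiv fun _ : Fin (n + 1) => ι).summable_iff, he]
      exact hs
    · rw [← (Fin.consEquiv fun _ : Fin (n + 1) => ι).tsum_eq]
      have := congrArg (fun g => ∑' p, g p) he
      simp only [Function.comp_def] at this
      rw [this, Fin.prod_univ_succ, ← h2,
        tsum_mul_tsum_of_summable_norm (f := f 0)
          (g := fun q : Fin n → ι => ∏ i, f (Fin.succ i) (q i)) (hf 0).norm h1.norm]

/-- Andréief's identity for sums over an arbitrary index set. -/
theorem hasSum_det_mul_det {ι : Type*} {N : ℕ} (A B : ι → Fin N → ℂ)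
    (hs : ∀ i j, Summable fun k => A k i * B k j) :
    HasSum (fun s : Fin N → ι => Matrix.det (Matrix.of fun i j => A (s i) j) *
        Matrix.det (Matrix.of fun i j => B (s i) j))
      (N.factorial * Matrix.det (Matrix.of fun i j => ∑' k, A k i * B k j)) := by
  have h1 : ∀ σ τ : Equiv.Perm (Fin N), HasSum (fun s : Fin N → ι =>
      ((σ.sign : ℤ) : ℂ) * ((τ.sign : ℤ) : ℂ) * ∏ i, (A (s i) (σ i) * B (s i) (τ i)))
      (((σ.sign : ℤ) : ℂ) * ((τ.sign : ℤ) : ℂ) * ∏ i, ∑' k, A k (σ i) * B k (τ i)) := by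
    intro σ τ
    obtain ⟨h1, h2⟩ := summable_prod_pi (fun i k => A k (σ i) * B k (τ i)) fun i => hs _ _
    rw [← h2]
    exact h1.hasSum.mul_left _
  have h2 := hasSum_sum (s := Finset.univ) fun σ _ =>
    hasSum_sum (s := Finset.univ) fun τ _ => h1 σ τ
  convert! h2 using 1
  · funext s
    rw [← Matrix.det_transpose, ← Matrix.det_transpose (Matrix.of fun i j => B (s i) j),
      Matrix.det_apply', Matrix.det_apply', Finset.sum_mul_sum]
    refine Finset.sum_congr rfl fun σ _ => Finset.sum_congr rfl fun τ _ => ?_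
    simp only [Matrix.transpose_apply, Matrix.of_apply, Finset.prod_mul_distrib]
    ring
  · have h3 : ∀ σ : Equiv.Perm (Fin N), ∑ τ : Equiv.Perm (Fin N),
        ((σ.sign : ℤ) : ℂ) * ((τ.sign : ℤ) : ℂ) * ∏ i, ∑' k, A k (σ i) * B k (τ i)
        = Matrix.det (Matrix.of fun i j => ∑' k, A k i * B k j) := by
      intro σ
      have h4 := Matrix.det_permute σ (Matrix.of fun i j => ∑' k, A k i * B k j)
      rw [← Matrix.det_transpose, Matrix.det_apply'] at h4
      simp only [Matrix.transpose_apply, Matrix.of_apply, Matrix.submatrix_apply, id] at h4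
      simp_rw [mul_assoc, ← Finset.mul_sum, h4, ← mul_assoc]
      rw [← Int.cast_mul, ← Units.val_mul, Int.units_mul_self]
      simp
    simp [h3, Fintype.card_perm]

/-- Orthogonal projection onto the span of linearly independent vectors. -/
theorem starProjection_span_eq_sum {H : Type*} [NormedAddCommGroup H] [InnerProductSpace ℂ H]
    {N : ℕ} (v : Fin N → H) (hv : LinearIndependent ℂ v)
    [(Submodule.span ℂ (Set.range v)).HasOrthogonalProjection] (f : H) :
    (Submodule.span ℂ (Set.range v)).starProjection f =
      ∑ j, ((Matrix.gram ℂ v)⁻¹.mulVec fun i => inner ℂ (v i) f) j • v j := by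
  have hdet : IsUnit (Matrix.gram ℂ v).det :=
    isUnit_iff_ne_zero.2 (Matrix.det_gram_ne_zero_iff_linearIndependent.2 hv)
  refine Submodule.eq_starProjection_of_mem_of_inner_eq_zero ?_ ?_
  · exact Submodule.sum_mem _ fun j _ => Submodule.smul_mem _ _ (Submodule.subset_span ⟨j, rfl⟩)
  · intro w hw
    induction hw using Submodule.span_induction with
    | zero => simp
    | add x y _ _ hx hy => rw [inner_add_right, hx, hy, add_zero]
    | smul a x _ hx => rw [inner_smul_right, hx, mul_zero]
    | mem x hx =>
      obtain ⟨k, rfl⟩ := hx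
      rw [← inner_conj_symm, inner_sub_right, inner_sum]
      have := congrFun (Matrix.mulVec_mulVec (fun i => inner ℂ (v i) f)
        (Matrix.gram ℂ v) (Matrix.gram ℂ v)⁻¹) k
      rw [Matrix.mul_nonsing_inv _ hdet, Matrix.one_mulVec] at this
      rw [← this, Matrix.mulVec, dotProduct]
      simp [Matrix.gram_apply, inner_smul_right, mul_comm]

open Classical in
theorem prod_weight_eq {ι : Type*} {N m : ℕ} (x : Fin m → ι) (hx : Function.Injective x)
    (s : Fin N → ι) (hs : Function.Injective s) {w : ℂ} (hw : w ≠ 0) :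
    w ^ m * ∏ i, (1 + (w⁻¹ - 1) * ∑ a, if s i = x a then (1 : ℂ) else 0) =
      ∏ a, if x a ∈ Set.range s then (1 : ℂ) else w := by
  have h1 : ∀ i, (1 + (w⁻¹ - 1) * ∑ a, if s i = x a then (1 : ℂ) else 0) =
      ∏ a, if s i = x a then w⁻¹ else 1 := by
    intro i
    by_cases h : ∃ a, s i = x a
    · obtain ⟨a, ha⟩ := h
      simp [ha, hx.eq_iff]
    · push Not at h
      simp [h]
  have h2 : w ^ m = ∏ _a : Fin m, w := by simp
  rw [h2, Finset.prod_congr rfl fun i _ => h1 i, Finset.prod_comm, ← Finset.prod_mul_distrib]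
  refine Finset.prod_congr rfl fun a _ => ?_
  by_cases h : ∃ i, s i = x a
  · obtain ⟨i, hi⟩ := h
    have : x a ∈ Set.range s := ⟨i, hi⟩
    simp only [← hi, hs.eq_iff, Finset.prod_ite_eq', Finset.mem_univ, if_true, Set.mem_range_self]
    exact mul_inv_cancel₀ hw
  · have h' : x a ∉ Set.range s := h
    push Not at h
    simp [h, h']

section Inclusion

variable {ι H : Type*} [NormedAddCommGroup H] [InnerProductSpace ℂ H] {N m : ℕ}

open Classical in
theorem hasSum_weighted_norm_det_sq (e : HilbertBasis ι ℂ H) (v : Fin N → H)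
    (hv : LinearIndependent ℂ v) [(Submodule.span ℂ (Set.range v)).HasOrthogonalProjection]
    (x : Fin m → ι) (hx : Function.Injective x) {w : ℂ} (hw : w ≠ 0) :
    HasSum (fun s : Fin N → ι => (∏ a, if x a ∈ Set.range s then (1 : ℂ) else w) *
        ((‖Matrix.det (Matrix.of fun i j => inner ℂ (e (s i)) (v j))‖ ^ 2 : ℝ) : ℂ))
      (N.factorial * ((Matrix.gram ℂ v).det *
        Matrix.det (w • (1 : Matrix (Fin m) (Fin m) ℂ) + (1 - w) • Matrix.of fun a b =>
          inner ℂ (e (x a)) ((Submodule.span ℂ (Set.range v)).starProjection (e (x b)))))) := by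
  set ω : ι → ℂ := fun k => 1 + (w⁻¹ - 1) * ∑ a, if k = x a then (1 : ℂ) else 0 with hω
  set C : Matrix (Fin m) (Fin N) ℂ := Matrix.of fun a j => inner ℂ (e (x a)) (v j) with hC
  have hK : (Matrix.of fun a b => inner ℂ (e (x a))
      ((Submodule.span ℂ (Set.range v)).starProjection (e (x b))))
      = C * (Matrix.gram ℂ v)⁻¹ * C.conjTranspose := by
    ext a b
    rw [Matrix.of_apply, starProjection_span_eq_sum v hv, inner_sum, Matrix.mul_assoc,
      Matrix.mul_apply]
    refine Finset.sum_congr rfl fun j _ => ?_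
    rw [inner_smul_right, mul_comm]
    simp [hC, Matrix.mul_apply, Matrix.mulVec, dotProduct]
  have hsum : ∀ i j, HasSum (fun k => (ω k * inner ℂ (v i) (e k)) * inner ℂ (e k) (v j))
      ((Matrix.gram ℂ v + ((w⁻¹ - 1) • C.conjTranspose) * C) i j) := by
    intro i j
    have h1 := e.hasSum_inner_mul_inner (v i) (v j)
    have h2 : HasSum (fun k => ∑ a, if k = x a then
        (w⁻¹ - 1) * (inner ℂ (v i) (e (x a)) * inner ℂ (e (x a)) (v j)) else 0)
        (∑ a, (w⁻¹ - 1) * (inner ℂ (v i) (e (x a)) * inner ℂ (e (x a)) (v j))) :=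
      hasSum_sum fun a _ => hasSum_ite_eq _ _
    convert! h1.add h2 using 1
    · funext k
      have : ∀ a, (if k = x a then
        (w⁻¹ - 1) * (inner ℂ (v i) (e (x a)) * inner ℂ (e (x a)) (v j)) else 0)
        = (w⁻¹ - 1) * (if k = x a then (1 : ℂ) else 0) *
          (inner ℂ (v i) (e k) * inner ℂ (e k) (v j)) := by
        intro a
        split_ifs with h
        · rw [h]; ring
        · ring
      rw [Finset.sum_congr rfl fun a _ => this a, ← Finset.sum_mul, ← Finset.mul_sum]
      simp only [hω]
      ring
    · simp [Matrix.gram_apply, Matrix.mul_apply, hC, Finset.mul_sum]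
  have hA := (hasSum_det_mul_det (fun k i => ω k * inner ℂ (v i) (e k))
    (fun k j => inner ℂ (e k) (v j)) fun i j => (hsum i j).summable).mul_left (w ^ m)
  have hdet : IsUnit (Matrix.gram ℂ v).det :=
    isUnit_iff_ne_zero.2 (Matrix.det_gram_ne_zero_iff_linearIndependent.2 hv)
  convert! hA using 1
  · funext s
    have h3 : Matrix.det (Matrix.of fun i j => ω (s i) * inner ℂ (v j) (e (s i))) =
        (∏ i, ω (s i)) * starRingEnd ℂ
          (Matrix.det (Matrix.of fun i j => inner ℂ (e (s i)) (v j))) := by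
      have := Matrix.det_mul_column (fun i => ω (s i))
        (Matrix.of fun i j => inner ℂ (v j) (e (s i)))
      simp only [Matrix.of_apply] at this
      rw [this, RingHom.map_det]
      congr 2
      ext i j
      simp
    rw [h3]
    by_cases hs : Function.Injective s
    · rw [← prod_weight_eq x hx s hs hw, Complex.ofReal_pow, ← Complex.conj_mul']
      ring
    · obtain ⟨i, j, hij, hne⟩ : ∃ i j, s i = s j ∧ i ≠ j := by
        simpa [Function.Injective] using hs
      have h0 : Matrix.det (Matrix.of fun i j => inner ℂ (e (s i)) (v j)) = 0 :=
        Matrix.det_zero_of_row_eq hne (by ext; simp [hij])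
      simp [h0]
  · have h4 : (Matrix.of fun i j => ∑' k, (ω k * inner ℂ (v i) (e k)) * inner ℂ (e k) (v j))
        = Matrix.gram ℂ v + ((w⁻¹ - 1) • C.conjTranspose) * C := by
      ext i j
      exact (hsum i j).tsum_eq
    rw [h4, Matrix.det_add_mul (hA := hdet), hK]
    have h5 : w • (1 : Matrix (Fin m) (Fin m) ℂ) +
        (1 - w) • (C * (Matrix.gram ℂ v)⁻¹ * C.conjTranspose)
        = w • (1 + C * (Matrix.gram ℂ v)⁻¹ * ((w⁻¹ - 1) • C.conjTranspose)) := by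
      rw [smul_add, Matrix.mul_smul, smul_smul, mul_sub, mul_inv_cancel₀ hw, mul_one]
    rw [h5, Matrix.det_smul, Fintype.card_fin]
    ring

open Classical in
/-- The squared minors of the coefficient matrix of `v` whose rows contain a given set of indices
sum up to the Gram determinant times a minor of the projection onto the span of `v`. -/
theorem hasSum_norm_det_sq_of_subset (e : HilbertBasis ι ℂ H) (v : Fin N → H)
    (hv : LinearIndependent ℂ v) [(Submodule.span ℂ (Set.range v)).HasOrthogonalProjection]
    (x : Fin m → ι) (hx : Function.Injective x) :
    HasSum (fun s : Fin N → ι =>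
        ((‖Matrix.det (Matrix.of fun i j => inner ℂ (e (s i)) (v j))‖ ^ 2 *
          if ∀ a, x a ∈ Set.range s then 1 else 0 : ℝ) : ℂ))
      (N.factorial * ((Matrix.gram ℂ v).det * Matrix.det (Matrix.of fun a b =>
          inner ℂ (e (x a)) ((Submodule.span ℂ (Set.range v)).starProjection (e (x b)))))) := by
  set D : (Fin N → ι) → ℝ := fun s =>
    ‖Matrix.det (Matrix.of fun i j => inner ℂ (e (s i)) (v j))‖ ^ 2 with hD
  have hDs : Summable D := by
    have := (hasSum_weighted_norm_det_sq e v hv x hx one_ne_zero).summable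
    simp only [ite_self, Finset.prod_const_one, one_mul] at this
    exact_mod_cast this
  have hD0 : ∀ s, 0 ≤ D s := fun s => by positivity
  have hle : ∀ (w : ℂ) (_ : ‖w‖ ≤ 1) (s : Fin N → ι),
      ‖(∏ a, if x a ∈ Set.range s then (1 : ℂ) else w) * (D s : ℂ)‖ ≤ D s := by
    intro w hw s
    rw [norm_mul, norm_prod, Complex.norm_real, Real.norm_of_nonneg (hD0 s)]
    refine mul_le_of_le_one_left (hD0 s) (Finset.prod_le_one (fun _ _ => norm_nonneg _) ?_)
    intro a _
    split_ifs
    · simp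
    · exact hw
  have hseq : Filter.Tendsto (fun n : ℕ => ((1 / ((n : ℝ) + 1) : ℝ) : ℂ)) Filter.atTop
      (nhds 0) := by
    have := (Complex.continuous_ofReal.tendsto 0).comp tendsto_one_div_add_atTop_nhds_zero_nat
    rw [Complex.ofReal_zero] at this
    exact this
  have h1 : Filter.Tendsto (fun n : ℕ => ∑' s : Fin N → ι,
      (∏ a, if x a ∈ Set.range s then (1 : ℂ) else ((1 / ((n : ℝ) + 1) : ℝ) : ℂ)) * (D s : ℂ))
      Filter.atTop (nhds (∑' s : Fin N → ι,
        (∏ a, if x a ∈ Set.range s then (1 : ℂ) else 0) * (D s : ℂ))) := by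
    refine tendsto_tsum_of_dominated_convergence hDs ?_ ?_
    · intro s
      refine Filter.Tendsto.mul_const _ (tendsto_finsetProd _ fun a _ => ?_)
      split_ifs
      · exact tendsto_const_nhds
      · exact hseq
    · refine Filter.Eventually.of_forall fun n s => hle _ ?_ s
      rw [Complex.norm_real, Real.norm_of_nonneg (by positivity)]
      rw [div_le_one (by positivity)]
      linarith [(Nat.cast_nonneg n : (0 : ℝ) ≤ n)]
  set K : Matrix (Fin m) (Fin m) ℂ := Matrix.of fun a b =>
    inner ℂ (e (x a)) ((Submodule.span ℂ (Set.range v)).starProjection (e (x b))) with hK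
  have h2 : Filter.Tendsto (fun n : ℕ => (N.factorial : ℂ) * ((Matrix.gram ℂ v).det *
      Matrix.det (((1 / ((n : ℝ) + 1) : ℝ) : ℂ) • (1 : Matrix (Fin m) (Fin m) ℂ) +
        (1 - ((1 / ((n : ℝ) + 1) : ℝ) : ℂ)) • K))) Filter.atTop
      (nhds ((N.factorial : ℂ) * ((Matrix.gram ℂ v).det *
        Matrix.det ((0 : ℂ) • (1 : Matrix (Fin m) (Fin m) ℂ) + (1 - (0 : ℂ)) • K)))) := by
    have hc : Continuous fun w : ℂ => (N.factorial : ℂ) * ((Matrix.gram ℂ v).det *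
        Matrix.det (w • (1 : Matrix (Fin m) (Fin m) ℂ) + (1 - w) • K)) := by
      refine continuous_const.mul (continuous_const.mul (Continuous.matrix_det ?_))
      fun_prop
    exact (hc.tendsto 0).comp hseq
  have h3 : ∀ n : ℕ, ∑' s : Fin N → ι,
      (∏ a, if x a ∈ Set.range s then (1 : ℂ) else ((1 / ((n : ℝ) + 1) : ℝ) : ℂ)) * (D s : ℂ)
      = (N.factorial : ℂ) * ((Matrix.gram ℂ v).det *
      Matrix.det (((1 / ((n : ℝ) + 1) : ℝ) : ℂ) • (1 : Matrix (Fin m) (Fin m) ℂ) +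
        (1 - ((1 / ((n : ℝ) + 1) : ℝ) : ℂ)) • K)) := fun n =>
    (hasSum_weighted_norm_det_sq e v hv x hx (by
      rw [Ne, Complex.ofReal_eq_zero]; positivity)).tsum_eq
  simp_rw [h3] at h1
  have h4 := tendsto_nhds_unique h1 h2
  simp only [zero_smul, zero_add, sub_zero, one_smul] at h4
  rw [← h4]
  have h5 : (fun s : Fin N → ι => ((D s * if ∀ a, x a ∈ Set.range s then 1 else 0 : ℝ) : ℂ))
      = fun s => (∏ a, if x a ∈ Set.range s then (1 : ℂ) else 0) * (D s : ℂ) := by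
    funext s
    rw [Finset.prod_ite_zero]
    simp only [Finset.mem_univ, forall_const, Finset.prod_const_one]
    split_ifs <;> simp
  rw [h5]
  exact (Summable.of_norm_bounded hDs (hle 0 (by simp))).hasSum

end Inclusion

theorem Partition'.part_eq_zero_iff (lam : Partition') {i : ℕ} :
    lam.part i = 0 ↔ lam.len ≤ i := by
  have hne : {N | lam.part N = 0}.Nonempty := by
    obtain ⟨N, hN⟩ := lam.ev_zero
    exact ⟨N, hN N le_rfl⟩
  constructor
  · exact fun h => Nat.sInf_le h
  · intro h
    have h1 : lam.part lam.len = 0 := Nat.sInf_mem hne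
    exact Nat.le_zero.1 (h1 ▸ lam.antitone h)

theorem Partition'.ext {lam mu : Partition'} (h : lam.part = mu.part) : lam = mu := by
  cases lam; cases mu; cases h; rfl

theorem schurPoly_eq_det_of_len_le {t : ℕ → ℂ} (h0 : hcoef t 0 = 1) (lam : Partition') {N : ℕ}
    (hN : lam.len ≤ N) :
    schurPoly t lam = Matrix.det (Matrix.of fun i j : Fin N =>
      hcoef t ((lam.part i : ℤ) + (j : ℤ) - (i : ℤ))) := by
  induction N, hN using Nat.le_induction with
  | base => rfl
  | succ n hn ih =>
    rw [ih, Matrix.det_succ_row _ (Fin.last n), Fin.sum_univ_castSucc]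
    have hp : lam.part n = 0 := lam.part_eq_zero_iff.2 hn
    have hz : ∀ j : Fin n, hcoef t ((lam.part (Fin.last n) : ℤ) + ((j.castSucc : Fin (n + 1)) : ℤ)
        - ((Fin.last n : Fin (n + 1)) : ℤ)) = 0 := by
      intro j
      rw [hcoef, if_pos]
      simp [hp]
    have hl : hcoef t ((lam.part (Fin.last n) : ℤ) + ((Fin.last n : Fin (n + 1)) : ℤ)
        - ((Fin.last n : Fin (n + 1)) : ℤ)) = 1 := by
      rw [add_sub_cancel_right, Fin.val_last, hp, Nat.cast_zero, h0]
    simp only [Matrix.of_apply, hz, hl]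
    simp only [mul_zero, zero_mul, Finset.sum_const_zero, zero_add, mul_one, Fin.val_last,
      Fin.succAbove_last]
    rw [Even.neg_one_pow ⟨n, rfl⟩, one_mul]
    rfl

/-- The first `N` points of the particle configuration attached to `lam`. -/
def Partition'.points (lam : Partition') (N : ℕ) : Fin N → ℤ := fun i => lam.part i - (i + 1)

theorem Partition'.points_strictAnti (lam : Partition') (N : ℕ) : StrictAnti (lam.points N) := by
  intro i j hij
  have h1 := lam.antitone (le_of_lt (Fin.lt_def.1 hij))
  have h2 := Fin.lt_def.1 hij
  simp only [Partition'.points]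
  omega

theorem StrictAnti.add_sub_le {N : ℕ} {u : Fin N → ℤ} (hu : StrictAnti u) {i j : Fin N}
    (hij : i ≤ j) : u j + j ≤ u i + i := by
  obtain ⟨j, hj⟩ := j
  obtain ⟨i, hi⟩ := i
  simp only [Fin.mk_le_mk] at hij
  induction j, hij using Nat.le_induction with
  | base => rfl
  | succ k hk ih =>
    have h1 := ih (by omega)
    have h2 : u ⟨k + 1, hj⟩ < u ⟨k, by omega⟩ := hu (Fin.mk_lt_mk.2 (by omega))
    push_cast at h1 ⊢
    omega

theorem exists_partition_points_comp {N : ℕ} (s : Fin N → ℤ) (hs : Function.Injective s)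
    (hN : ∀ i, -(N : ℤ) ≤ s i) :
    ∃ (lam : Partition') (σ : Equiv.Perm (Fin N)), lam.len ≤ N ∧ lam.points N ∘ σ = s := by
  set τ := Tuple.sort fun i => -s i with hτ
  have hu : StrictAnti (s ∘ τ) := by
    have h1 : Antitone (s ∘ τ) := fun i j hij =>
      neg_le_neg_iff.1 (Tuple.monotone_sort (fun i => -s i) hij)
    exact h1.strictAnti_of_injective (hs.comp τ.injective)
  set u := s ∘ τ with hu'
  have huN : ∀ i : Fin N, 0 ≤ u i + (i + 1) := by
    intro i
    have hi := i.2
    have h2 := hu.add_sub_le (i := i) (j := ⟨N - 1, by omega⟩) (Fin.le_def.2 (by simp; omega))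
    have h3 := hN (τ ⟨N - 1, by omega⟩)
    simp only [hu', Function.comp_apply] at h2 ⊢
    omega
  let lam : Partition' :=
    { part := fun i => if h : i < N then (u ⟨i, h⟩ + (i + 1)).toNat else 0
      antitone := by
        intro i j hij
        dsimp only
        split_ifs with h1 h2
        · have := hu.add_sub_le (i := ⟨i, h2⟩) (j := ⟨j, h1⟩) hij
          dsimp only at this
          omega
        · omega
        · omega
        · rfl
      ev_zero := ⟨N, fun i hi => by simp [not_lt.2 hi]⟩ }
  refine ⟨lam, τ.symm, lam.part_eq_zero_iff.1 (by simp [lam]), ?_⟩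
  have h5 : lam.points N = u := by
    funext i
    have := huN i
    simp only [Partition'.points, lam, i.2, dif_pos, Fin.eta]
    omega
  rw [h5, hu']
  funext i
  simp

open Classical in
/-- A sum of a symmetric function over all `N`-tuples of integers which is supported on injective
tuples bounded below by `-N` is `N!` times a sum over partitions with at most `N` parts. -/
theorem hasSum_partition_of_hasSum_tuple {N : ℕ} {F : (Fin N → ℤ) → ℂ} {a : ℂ}
    (hF : HasSum F (N.factorial * a)) (hsymm : ∀ s (σ : Equiv.Perm (Fin N)), F (s ∘ σ) = F s)
    (hsupp : ∀ s, F s ≠ 0 → Function.Injective s ∧ ∀ i, -(N : ℤ) ≤ s i) :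
    HasSum (fun lam : Partition' => if lam.len ≤ N then F (lam.points N) else 0) a := by
  let Φ : {lam : Partition' // lam.len ≤ N} × Equiv.Perm (Fin N) → (Fin N → ℤ) :=
    fun p => p.1.1.points N ∘ p.2
  have hΦ : Function.Injective Φ := by
    rintro ⟨⟨lam, hl⟩, σ⟩ ⟨⟨mu, hm⟩, τ⟩ h
    simp only [Φ] at h
    have h1 : lam.points N = mu.points N := by
      refine ((lam.points_strictAnti N).range_inj (mu.points_strictAnti N)).1 ?_
      rw [← σ.surjective.range_comp (lam.points N), h, τ.surjective.range_comp]
    have h2 : lam = mu := by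
      refine Partition'.ext (funext fun i => ?_)
      by_cases hi : i < N
      · have := congrFun h1 ⟨i, hi⟩
        simp only [Partition'.points] at this
        omega
      · rw [lam.part_eq_zero_iff.2 (by omega), mu.part_eq_zero_iff.2 (by omega)]
    subst h2
    have h3 : σ = τ := Equiv.ext fun i =>
      (lam.points_strictAnti N).injective (congrFun h i)
    subst h3
    rfl
  have h1 : HasSum (F ∘ Φ) (N.factorial * a) := by
    refine (hΦ.hasSum_iff fun s hs => ?_).2 hF
    by_contra h
    obtain ⟨hi, hN⟩ := hsupp s h
    obtain ⟨lam, σ, hl, hσ⟩ := exists_partition_points_comp s hi hN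
    exact hs ⟨(⟨lam, hl⟩, σ), hσ⟩
  have h2 : HasSum (fun lam : {lam : Partition' // lam.len ≤ N} =>
      (N.factorial : ℂ) * F (lam.1.points N)) (N.factorial * a) := by
    refine h1.prod_fiberwise fun lam => ?_
    have h4 : (fun σ : Equiv.Perm (Fin N) => (F ∘ Φ) (lam, σ)) = fun _ => F (lam.1.points N) := by
      funext σ
      exact hsymm _ _
    rw [h4]
    convert! hasSum_fintype (fun _ : Equiv.Perm (Fin N) => F (lam.1.points N)) using 1
    simp [Fintype.card_perm]
  have h3 : (N.factorial : ℂ) ≠ 0 := by exact_mod_cast N.factorial_ne_zero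
  have h4 := (hasSum_mul_left_iff h3).1 h2
  have h5 := (hasSum_subtype_iff_indicator
    (f := fun lam : Partition' => F (lam.points N)) (s := {lam | lam.len ≤ N})).1 h4
  convert! h5 using 1
  funext lam
  rw [Set.indicator_apply]
  rfl

instance : Fact (0 < 2 * Real.pi) := ⟨Real.two_pi_pos⟩

/-- The circle `ℝ / 2πℤ`. -/
abbrev Circ := AddCircle (2 * Real.pi)

/-- The Hilbert space `L²` of the circle, with normalised Haar measure. -/
abbrev CircL2 := MeasureTheory.Lp ℂ 2 (AddCircle.haarAddCircle (T := 2 * Real.pi))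

/-- The embedding of continuous functions into `L²`. -/
def toL2 : C(Circ, ℂ) →L[ℂ] CircL2 :=
  ContinuousMap.toLp 2 AddCircle.haarAddCircle ℂ

/-- The `k`-th Fourier coefficient as a continuous linear functional. -/
def cf (k : ℤ) : C(Circ, ℂ) →L[ℂ] ℂ :=
  (innerSL ℂ (toL2 (fourier k))).comp toL2

theorem inner_fourier_toL2 (k : ℤ) (f : C(Circ, ℂ)) :
    inner ℂ (toL2 (fourier k)) (toL2 f) = cf k f := rfl

theorem star_fourier (k : ℤ) : star (fourier k : C(Circ, ℂ)) = fourier (-k) := by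
  ext x
  rw [fourier_neg]
  rfl

theorem fourier_mul (j k : ℤ) : (fourier j : C(Circ, ℂ)) * fourier k = fourier (j + k) := by
  ext x
  rw [fourier_add]
  rfl

theorem fourier_zero_eq_one : (fourier 0 : C(Circ, ℂ)) = 1 := by
  ext x
  rw [fourier_zero]
  rfl

theorem inner_toL2 (f g : C(Circ, ℂ)) : inner ℂ (toL2 f) (toL2 g) = cf 0 (star f * g) := by
  rw [← inner_fourier_toL2]
  simp only [toL2]
  rw [MeasureTheory.ContinuousMap.inner_toLp, MeasureTheory.ContinuousMap.inner_toLp]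
  refine MeasureTheory.integral_congr_ae (Filter.Eventually.of_forall fun x => ?_)
  simp [fourier_zero_eq_one, mul_comm]

theorem cf_eq (k : ℤ) (f : C(Circ, ℂ)) : cf k f = cf 0 (fourier (-k) * f) := by
  rw [← inner_fourier_toL2, inner_toL2, star_fourier]

theorem cf_fourier_mul (k j : ℤ) (f : C(Circ, ℂ)) : cf k (fourier j * f) = cf (k - j) f := by
  rw [cf_eq, cf_eq (k - j), ← mul_assoc, fourier_mul, neg_sub, neg_add_eq_sub]

theorem cf_star (k : ℤ) (f : C(Circ, ℂ)) : cf k (star f) = starRingEnd ℂ (cf (-k) f) := by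
  rw [← inner_fourier_toL2, ← inner_fourier_toL2, inner_conj_symm, inner_toL2, inner_toL2,
    star_fourier, mul_comm (star f)]

theorem cf_eq_fourierCoeff (k : ℤ) (f : C(Circ, ℂ)) : cf k f = fourierCoeff f k := by
  rw [← inner_fourier_toL2, toL2, MeasureTheory.ContinuousMap.inner_toLp, fourierCoeff]
  refine MeasureTheory.integral_congr_ae (Filter.Eventually.of_forall fun x => ?_)
  dsimp only
  rw [fourier_neg, smul_eq_mul, mul_comm]

theorem cf_eq_integral (k : ℤ) (f : C(Circ, ℂ)) : cf k f = (2 * Real.pi : ℂ)⁻¹ *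
    ∫ θ in (0:ℝ)..(2 * Real.pi), f (θ : Circ) * Complex.exp (-(k : ℂ) * θ * Complex.I) := by
  rw [cf_eq_fourierCoeff, fourierCoeff_eq_intervalIntegral _ _ 0, zero_add]
  rw [← Complex.coe_smul, smul_eq_mul]
  congr 1
  · push_cast
    rw [one_div]
  · refine intervalIntegral.integral_congr fun θ _ => ?_
    rw [fourier_coe_apply, smul_eq_mul, mul_comm]
    congr 2
    have : (Real.pi : ℂ) ≠ 0 := by exact_mod_cast Real.pi_ne_zero
    push_cast
    field_simp

theorem cf_fourier (k j : ℤ) : cf k (fourier j) = if k = j then 1 else 0 := by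
  rw [← inner_fourier_toL2]
  exact (orthonormal_iff_ite.1 (orthonormal_fourier (T := 2 * Real.pi))) k j

theorem hasSum_cf_mul (n : ℤ) (f g : C(Circ, ℂ)) :
    HasSum (fun a : ℤ => cf (n - a) f * cf a g) (cf n (f * g)) := by
  have h := (fourierBasis (T := 2 * Real.pi)).hasSum_inner_mul_inner
    (toL2 (star f * fourier n)) (toL2 g)
  rw [coe_fourierBasis] at h
  convert! h using 1
  · funext a
    have h1 : inner ℂ (toL2 (star f * fourier n)) (fourierLp 2 a) = cf (n - a) f := by
      change inner ℂ (toL2 (star f * fourier n)) (toL2 (fourier a)) = _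
      rw [inner_toL2, star_mul, star_star, star_fourier, cf_eq (n - a), mul_right_comm,
        fourier_mul]
      congr 3
      ring
    rw [h1]
    rfl
  · rw [inner_toL2, star_mul, star_star, star_fourier, cf_eq n, mul_assoc]

/-- The closed algebra of continuous functions generated by `e^{iθ}`. -/
def discAlg : Subalgebra ℂ C(Circ, ℂ) :=
  (Algebra.adjoin ℂ {(fourier 1 : C(Circ, ℂ))}).topologicalClosure

theorem fourier_one_pow (n : ℕ) : (fourier 1 : C(Circ, ℂ)) ^ n = fourier n := by
  induction n with
  | zero => simpa using fourier_zero_eq_one.symm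
  | succ n ih =>
    rw [pow_succ, ih, fourier_mul]
    push_cast
    rfl

theorem fourier_mem_discAlg (n : ℕ) : (fourier n : C(Circ, ℂ)) ∈ discAlg := by
  rw [← fourier_one_pow]
  have h : (fourier 1 : C(Circ, ℂ)) ∈ discAlg :=
    Subalgebra.le_topologicalClosure _ (Algebra.subset_adjoin (Set.mem_singleton _))
  exact pow_mem h n

theorem isClosed_discAlg : IsClosed (discAlg : Set C(Circ, ℂ)) :=
  Subalgebra.isClosed_topologicalClosure _

theorem exp_mem_discAlg {f : C(Circ, ℂ)} (hf : f ∈ discAlg) : NormedSpace.exp f ∈ discAlg := by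
  have h : HasSum (fun n : ℕ => ((n.factorial : ℂ)⁻¹) • f ^ n) (NormedSpace.exp f) :=
    NormedSpace.exp_series_hasSum_exp' (𝕂 := ℂ) f
  have h2 : ∀ s : Finset ℕ, ∑ n ∈ s, ((n.factorial : ℂ)⁻¹) • f ^ n ∈ discAlg := fun s =>
    sum_mem fun n _ => Subalgebra.smul_mem _ (pow_mem hf n) _
  exact isClosed_discAlg.mem_of_tendsto (b := .atTop) h (Filter.Eventually.of_forall h2)

/-- To prove a closed linear condition on `discAlg`, it is enough to check it on monomials. -/
theorem discAlg_induction {M : Submodule ℂ C(Circ, ℂ)} (hM : IsClosed (M : Set C(Circ, ℂ)))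
    (h : ∀ n : ℕ, (fourier n : C(Circ, ℂ)) ∈ M) {f : C(Circ, ℂ)} (hf : f ∈ discAlg) : f ∈ M := by
  refine closure_minimal ?_ hM hf
  intro g hg
  have hg' : g ∈ Subalgebra.toSubmodule (Algebra.adjoin ℂ {(fourier 1 : C(Circ, ℂ))}) := hg
  rw [Algebra.adjoin_eq_span] at hg'
  refine Submodule.span_le.2 ?_ hg'
  intro y hy
  obtain ⟨n, rfl⟩ := Submonoid.mem_closure_singleton.1 hy
  rw [fourier_one_pow]
  exact h n

theorem cf_eq_zero_of_mem_discAlg {f : C(Circ, ℂ)} (hf : f ∈ discAlg) {k : ℤ} (hk : k < 0) :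
    cf k f = 0 := by
  have : f ∈ LinearMap.ker (cf k : C(Circ, ℂ) →ₗ[ℂ] ℂ) := by
    refine discAlg_induction (cf k).isClosed_ker (fun n => ?_) hf
    rw [LinearMap.mem_ker]
    change cf k (fourier n) = 0
    rw [cf_fourier, if_neg (by omega)]
  exact this

theorem cf_mul_of_mem_discAlg {f g : C(Circ, ℂ)} (hf : f ∈ discAlg) (hg : g ∈ discAlg) (n : ℕ) :
    cf n (f * g) = ∑ a ∈ Finset.range (n + 1), cf ((n : ℤ) - a) f * cf a g := by
  have h := hasSum_cf_mul n f g
  have h2 : HasSum (fun a : ℕ => cf ((n : ℤ) - a) f * cf a g) (cf n (f * g)) := by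
    refine (Function.Injective.hasSum_iff Nat.cast_injective (f := fun a : ℤ =>
      cf ((n : ℤ) - a) f * cf a g) fun a ha => ?_).2 h
    rw [cf_eq_zero_of_mem_discAlg hg, mul_zero]
    by_contra h'
    exact ha ⟨a.toNat, by simp; omega⟩
  refine h2.unique (hasSum_sum_of_ne_finset_zero fun a ha => ?_)
  rw [Finset.mem_range] at ha
  rw [cf_eq_zero_of_mem_discAlg hf (by omega), zero_mul]

theorem cf_zero_exp {f : C(Circ, ℂ)} (hf : f ∈ discAlg) :
    cf 0 (NormedSpace.exp f) = NormedSpace.exp (cf 0 f) := by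
  have hp : ∀ n : ℕ, cf 0 (f ^ n) = cf 0 f ^ n := by
    intro n
    induction n with
    | zero =>
      rw [pow_zero, pow_zero, ← fourier_zero_eq_one, cf_fourier, if_pos rfl]
    | succ n ih =>
      have := cf_mul_of_mem_discAlg (pow_mem hf n) hf 0
      simp only [zero_add, Finset.range_one, Finset.sum_singleton, Nat.cast_zero, sub_zero] at this
      rw [pow_succ, this, ih, pow_succ]
  have h1 := (NormedSpace.exp_series_hasSum_exp' (𝕂 := ℂ) f).mapL (cf 0)
  have h2 := NormedSpace.exp_series_hasSum_exp' (𝕂 := ℂ) (cf 0 f)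
  refine h1.unique ?_
  simpa only [map_smul, hp] using h2

theorem exp_mul_exp_neg_self (f : C(Circ, ℂ)) : NormedSpace.exp f * NormedSpace.exp (-f) = 1 := by
  rw [← NormedSpace.exp_add, add_neg_cancel, NormedSpace.exp_zero]

/-- The functions `γ(z) z^{-(j+1)}` with `γ = exp τ`. -/
def vvec (τ : C(Circ, ℂ)) (j : ℕ) : CircL2 :=
  toL2 (NormedSpace.exp τ * fourier (-((j : ℤ) + 1)))

/-- The family biorthogonal to `vvec`. -/
def uvec (τ : C(Circ, ℂ)) (i : ℕ) : CircL2 :=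
  toL2 (star (NormedSpace.exp (-τ)) * fourier (-((i : ℤ) + 1)))

/-- The orthonormal family `J(z) z^{-(c+1)}` with `J = exp (τ - τ*)`. -/
def wvec (τ : C(Circ, ℂ)) (c : ℕ) : CircL2 :=
  toL2 (NormedSpace.exp (τ - star τ) * fourier (-((c : ℤ) + 1)))

theorem inner_uvec_toL2 (τ g : C(Circ, ℂ)) (i : ℕ) :
    inner ℂ (uvec τ i) (toL2 g) = cf 0 (NormedSpace.exp (-τ) * fourier ((i : ℤ) + 1) * g) := by
  rw [uvec, inner_toL2, star_mul, star_star, star_fourier, neg_neg, mul_comm (fourier _)]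

theorem inner_uvec_vvec (τ : C(Circ, ℂ)) (i j : ℕ) :
    inner ℂ (uvec τ i) (vvec τ j) = if i = j then 1 else 0 := by
  rw [vvec, inner_uvec_toL2]
  have : NormedSpace.exp (-τ) * fourier ((i : ℤ) + 1) *
      (NormedSpace.exp τ * fourier (-((j : ℤ) + 1))) = fourier ((i : ℤ) - j) := by
    rw [mul_mul_mul_comm, mul_comm (NormedSpace.exp (-τ)), exp_mul_exp_neg_self, one_mul, fourier_mul]
    congr 1
    ring
  rw [this, cf_fourier]
  congr 1
  simp only [eq_iff_iff]
  omega

theorem orthonormal_wvec (τ : C(Circ, ℂ)) : Orthonormal ℂ (wvec τ) := by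
  rw [orthonormal_iff_ite]
  intro i j
  rw [wvec, wvec, inner_toL2]
  have : star (NormedSpace.exp (τ - star τ) * fourier (-((i : ℤ) + 1))) *
      (NormedSpace.exp (τ - star τ) * fourier (-((j : ℤ) + 1))) = fourier ((i : ℤ) - j) := by
    rw [star_mul, NormedSpace.star_exp, star_sub, star_star, star_fourier, neg_neg,
      mul_comm (fourier _), mul_mul_mul_comm, mul_comm (NormedSpace.exp _), ← neg_sub τ,
      exp_mul_exp_neg_self, one_mul, fourier_mul]
    congr 1
    ring
  rw [this, cf_fourier]
  congr 1
  simp only [eq_iff_iff]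
  omega

/-- The span of the first `N` vectors of a sequence. -/
def spanN (v : ℕ → CircL2) (N : ℕ) : Submodule ℂ CircL2 :=
  Submodule.span ℂ (Set.range fun j : Fin N => v j)

instance (v : ℕ → CircL2) (N : ℕ) : FiniteDimensional ℂ (spanN v N) :=
  FiniteDimensional.span_of_finite ℂ (Set.finite_range _)

theorem spanN_mono (v : ℕ → CircL2) : Monotone (spanN v) := by
  intro M N h
  refine Submodule.span_mono ?_
  rintro _ ⟨j, rfl⟩
  exact ⟨Fin.castLE h j, rfl⟩

theorem mem_spanN (v : ℕ → CircL2) {j N : ℕ} (h : j < N) : v j ∈ spanN v N :=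
  Submodule.subset_span ⟨⟨j, h⟩, rfl⟩

/-- The closed span of a sequence. -/
abbrev spanInf (v : ℕ → CircL2) : Submodule ℂ CircL2 :=
  (⨆ N, spanN v N).topologicalClosure

theorem mem_spanInf (v : ℕ → CircL2) (j : ℕ) : v j ∈ spanInf v :=
  Submodule.le_topologicalClosure _
    (Submodule.mem_iSup_of_mem (j + 1) (mem_spanN v (Nat.lt_succ_self j)))

theorem spanInf_le {v : ℕ → CircL2} {K : Submodule ℂ CircL2} (hK : IsClosed (K : Set CircL2))
    (h : ∀ j, v j ∈ K) : spanInf v ≤ K := by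
  refine Submodule.topologicalClosure_minimal _ (iSup_le fun N => Submodule.span_le.2 ?_) hK
  rintro _ ⟨j, rfl⟩
  exact h j

theorem toL2_mul_star_mem {K : Submodule ℂ CircL2} (hK : IsClosed (K : Set CircL2))
    (g : C(Circ, ℂ)) (h : ∀ n : ℕ, toL2 (g * fourier (-(n : ℤ))) ∈ K) {f : C(Circ, ℂ)}
    (hf : f ∈ discAlg) : toL2 (g * star f) ∈ K := by
  let M : Submodule ℂ C(Circ, ℂ) :=
    { carrier := {f | toL2 (g * star f) ∈ K}
      zero_mem' := by simp
      add_mem' := by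
        intro a b ha hb
        simp only [Set.mem_ofPred_eq] at *
        rw [star_add, mul_add, map_add]
        exact add_mem ha hb
      smul_mem' := by
        intro c a ha
        simp only [Set.mem_ofPred_eq] at *
        rw [star_smul, mul_smul_comm, map_smul]
        exact K.smul_mem _ ha }
  have hM : IsClosed (M : Set C(Circ, ℂ)) := by
    refine hK.preimage (f := fun f : C(Circ, ℂ) => toL2 (g * star f)) ?_
    exact toL2.continuous.comp (continuous_const.mul continuous_star)
  refine discAlg_induction (M := M) hM (fun n => ?_) hf
  change toL2 (g * star (fourier (n : ℤ))) ∈ K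
  rw [star_fourier]
  exact h n

theorem spanInf_wvec {τ : C(Circ, ℂ)} (hτ : τ ∈ discAlg) : spanInf (wvec τ) = spanInf (vvec τ) := by
  apply le_antisymm
  · refine spanInf_le (Submodule.isClosed_topologicalClosure _) fun c => ?_
    have := toL2_mul_star_mem (K := spanInf (vvec τ)) (Submodule.isClosed_topologicalClosure _)
      (NormedSpace.exp τ * fourier (-((c : ℤ) + 1))) (fun n => ?_)
      (exp_mem_discAlg (neg_mem hτ))
    · convert! this using 1
      rw [wvec, NormedSpace.star_exp, star_neg, sub_eq_add_neg, NormedSpace.exp_add, mul_right_comm]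
    · convert! mem_spanInf (vvec τ) (c + n) using 1
      rw [vvec, mul_assoc, fourier_mul]
      congr 3
      push_cast
      ring
  · refine spanInf_le (Submodule.isClosed_topologicalClosure _) fun c => ?_
    have := toL2_mul_star_mem (K := spanInf (wvec τ)) (Submodule.isClosed_topologicalClosure _)
      (NormedSpace.exp (τ - star τ) * fourier (-((c : ℤ) + 1))) (fun n => ?_)
      (exp_mem_discAlg hτ)
    · convert! this using 1
      rw [vvec, NormedSpace.star_exp, mul_right_comm, ← NormedSpace.exp_add, sub_add_cancel]
    · convert! mem_spanInf (wvec τ) (c + n) using 1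
      rw [wvec, mul_assoc, fourier_mul]
      congr 3
      push_cast
      ring

theorem linearIndependent_vvec (τ : C(Circ, ℂ)) (N : ℕ) :
    LinearIndependent ℂ fun j : Fin N => vvec τ j := by
  rw [Fintype.linearIndependent_iff]
  intro g hg i
  have := congrArg (inner ℂ (uvec τ i)) hg
  simpa [inner_sum, inner_smul_right, inner_uvec_vvec, Fin.val_inj] using this

theorem tendsto_starProjection_spanN (v : ℕ → CircL2) (g : CircL2) :
    Filter.Tendsto (fun N => (spanN v N).starProjection g) .atTop
      (nhds ((spanInf v).starProjection g)) :=
  Submodule.starProjection_tendsto_closure_iSup _ (spanN_mono v) g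

theorem tendsto_inner_starProjection_spanN (v : ℕ → CircL2) (f g : CircL2) :
    Filter.Tendsto (fun N => inner ℂ f ((spanN v N).starProjection g)) .atTop
      (nhds (inner ℂ f ((spanInf v).starProjection g))) :=
  ((innerSL ℂ f).continuous.tendsto _).comp (tendsto_starProjection_spanN v g)

theorem starProjection_spanN_of_orthonormal {w : ℕ → CircL2} (hw : Orthonormal ℂ w) (N : ℕ)
    (g : CircL2) : (spanN w N).starProjection g =
      ∑ j ∈ Finset.range N, inner ℂ (w j) g • w j := by
  have hw' : Orthonormal ℂ fun j : Fin N => w j := hw.comp _ Fin.val_injective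
  have : (Submodule.span ℂ (Set.range fun j : Fin N => w j)).HasOrthogonalProjection :=
    inferInstanceAs (spanN w N).HasOrthogonalProjection
  have h := starProjection_span_eq_sum (fun j : Fin N => w j) hw'.linearIndependent g
  rw [Matrix.gram_eq_one_iff_orthonormal.2 hw', inv_one] at h
  simp only [Matrix.one_mulVec] at h
  rw [Finset.sum_range]
  exact h

theorem hasSum_inner_wvec {w : ℕ → CircL2} (hw : Orthonormal ℂ w) (f g : CircL2) :
    HasSum (fun c => inner ℂ f (w c) * inner ℂ (w c) g)
      (inner ℂ f ((spanInf w).starProjection g)) := by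
  have hs : Summable fun c => inner ℂ f (w c) * inner ℂ (w c) g := by
    refine Summable.of_norm_bounded
      ((hw.inner_products_summable f).add (hw.inner_products_summable g)) fun c => ?_
    rw [norm_mul, norm_inner_symm f]
    nlinarith [sq_nonneg (‖inner ℂ (w c) f‖ - ‖inner ℂ (w c) g‖), sq_nonneg ‖inner ℂ (w c) f‖,
      sq_nonneg ‖inner ℂ (w c) g‖]
  have h1 := hs.hasSum.tendsto_sum_nat
  have h2 := tendsto_inner_starProjection_spanN w f g
  have h3 : ∀ N, inner ℂ f ((spanN w N).starProjection g) =
      ∑ c ∈ Finset.range N, inner ℂ f (w c) * inner ℂ (w c) g := fun N => by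
    rw [starProjection_spanN_of_orthonormal hw, inner_sum]
    refine Finset.sum_congr rfl fun c _ => ?_
    rw [inner_smul_right, mul_comm]
  simp only [h3] at h2
  rw [← tendsto_nhds_unique h1 h2]
  exact hs.hasSum

/-- `g = -i f'` in the sense of Fourier coefficients. -/
def IsCircDeriv (f g : C(Circ, ℂ)) : Prop := ∀ k : ℤ, (k : ℂ) * cf k f = cf k g

theorem isCircDeriv_fourier (n : ℤ) : IsCircDeriv (fourier n) ((n : ℂ) • fourier n) := by
  intro k
  rw [map_smul, cf_fourier]
  split_ifs with h
  · rw [h]; rfl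
  · simp

theorem IsCircDeriv.mul {f g f' g' : C(Circ, ℂ)} (h : IsCircDeriv f g) (h' : IsCircDeriv f' g') :
    IsCircDeriv (f * f') (g * f' + f * g') := by
  intro k
  have h1 := (hasSum_cf_mul k g f').add (hasSum_cf_mul k f g')
  have h2 := (hasSum_cf_mul k f f').mul_left (k : ℂ)
  rw [map_add]
  refine h2.unique ?_
  convert! h1 using 2 with a
  rw [← h, ← h']
  push_cast
  ring

theorem IsCircDeriv.pow {f g : C(Circ, ℂ)} (h : IsCircDeriv f g) (n : ℕ) :
    IsCircDeriv (f ^ (n + 1)) ((n + 1 : ℂ) • (f ^ n * g)) := by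
  induction n with
  | zero => simpa using h
  | succ n ih =>
    have := ih.mul h
    rw [← pow_succ] at this
    convert! this using 1
    ext x
    simp
    ring

theorem IsCircDeriv.const_smul {f g : C(Circ, ℂ)} (h : IsCircDeriv f g) (c : ℂ) :
    IsCircDeriv (c • f) (c • g) := by
  intro k
  rw [map_smul, map_smul, ← h k, smul_eq_mul, smul_eq_mul]
  ring

theorem IsCircDeriv.hasSum {F G : ℕ → C(Circ, ℂ)} {f g : C(Circ, ℂ)} (hF : HasSum F f)
    (hG : HasSum G g) (h : ∀ n, IsCircDeriv (F n) (G n)) : IsCircDeriv f g := by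
  intro k
  refine ((hF.mapL (cf k)).mul_left (k : ℂ)).unique ?_
  simpa only [h _ k] using hG.mapL (cf k)

theorem IsCircDeriv.exp {f g : C(Circ, ℂ)} (h : IsCircDeriv f g) :
    IsCircDeriv (NormedSpace.exp f) (NormedSpace.exp f * g) := by
  have h1 : HasSum (fun n : ℕ => ((n.factorial : ℂ)⁻¹) • f ^ n) (NormedSpace.exp f) :=
    NormedSpace.exp_series_hasSum_exp' (𝕂 := ℂ) f
  have h2 : HasSum (fun n : ℕ => (((n + 1).factorial : ℂ)⁻¹) • f ^ (n + 1))
      (NormedSpace.exp f - 1) := by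
    have := (hasSum_nat_add_iff' 1).2 h1
    simpa using this
  have h3 := h1.mul_right g
  have h4 : IsCircDeriv (NormedSpace.exp f - 1) (NormedSpace.exp f * g) := by
    refine IsCircDeriv.hasSum h2 h3 fun n => ?_
    convert! (h.pow n).const_smul (((n + 1).factorial : ℂ)⁻¹) using 1
    rw [smul_smul, smul_mul_assoc, Nat.factorial_succ]
    congr 1
    have : (n + 1 : ℂ) ≠ 0 := by exact_mod_cast Nat.succ_ne_zero n
    push_cast
    field_simp
  intro k
  rw [← h4 k, map_sub, ← fourier_zero_eq_one, cf_fourier]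
  split_ifs with hk
  · simp [hk]
  · simp

theorem starProjection_congr {K L : Submodule ℂ CircL2} [K.HasOrthogonalProjection]
    [L.HasOrthogonalProjection] (h : K = L) (g : CircL2) :
    K.starProjection g = L.starProjection g := by
  subst h
  rfl

/-- The functions `g(z) γ(z) z^{-(i+1)}` with `γ = exp τ`. -/
def fvec (τ g : C(Circ, ℂ)) (i : ℕ) : CircL2 :=
  toL2 (g * NormedSpace.exp τ * fourier (-((i : ℤ) + 1)))

theorem inner_uvec_wvec (τ : C(Circ, ℂ)) (i c : ℕ) :
    inner ℂ (uvec τ i) (wvec τ c) =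
      starRingEnd ℂ (cf ((i : ℤ) - c) (NormedSpace.exp (-τ))) := by
  have : NormedSpace.exp (-τ) * fourier ((i : ℤ) + 1) *
      (NormedSpace.exp (τ - star τ) * fourier (-((c : ℤ) + 1))) =
      fourier ((i : ℤ) - c) * star (NormedSpace.exp (-τ)) := by
    rw [mul_mul_mul_comm, ← NormedSpace.exp_add, fourier_mul, NormedSpace.star_exp, star_neg,
      mul_comm (NormedSpace.exp _)]
    congr 2
    · ring
    · abel
  rw [wvec, inner_uvec_toL2, this, cf_fourier_mul, cf_star]
  congr 3
  ring

theorem inner_wvec_fvec (τ : C(Circ, ℂ)) (c i n : ℕ) :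
    inner ℂ (wvec τ c) (fvec τ (fourier n) i) =
      starRingEnd ℂ (cf ((n : ℤ) - (i - c)) (NormedSpace.exp τ)) := by
  have : star (NormedSpace.exp (τ - star τ) * fourier (-((c : ℤ) + 1))) *
      (fourier n * NormedSpace.exp τ * fourier (-((i : ℤ) + 1))) =
      fourier ((n : ℤ) - (i - c)) * star (NormedSpace.exp τ) := by
    rw [star_mul, NormedSpace.star_exp, NormedSpace.star_exp, star_sub, star_star, star_fourier, neg_neg]
    have h1 : NormedSpace.exp (star τ) = NormedSpace.exp (star τ - τ) * NormedSpace.exp τ := by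
      rw [← NormedSpace.exp_add, sub_add_cancel]
    have h2 : (fourier ((n : ℤ) - (i - c)) : C(Circ, ℂ)) =
        fourier ((c : ℤ) + 1) * fourier n * fourier (-((i : ℤ) + 1)) := by
      rw [fourier_mul, fourier_mul]
      congr 1
      ring
    rw [h1, h2]
    ring
  rw [wvec, fvec, inner_toL2, this, cf_fourier_mul, cf_star]
  congr 3
  ring

theorem inner_uvec_starProjection_fvec {τ : C(Circ, ℂ)} (hτ : τ ∈ discAlg) (i n : ℕ) :
    inner ℂ (uvec τ i) ((spanInf (vvec τ)).starProjection (fvec τ (fourier n) i)) =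
      starRingEnd ℂ (∑ a ∈ Finset.range (i + 1),
        cf a (NormedSpace.exp (-τ)) * cf ((n : ℤ) - a) (NormedSpace.exp τ)) := by
  rw [starProjection_congr (spanInf_wvec hτ).symm]
  refine (hasSum_inner_wvec (orthonormal_wvec τ) _ _).unique ?_
  rw [map_sum, ← Finset.sum_range_reflect]
  have : ∀ j ∈ Finset.range (i + 1), starRingEnd ℂ (cf ((i + 1 - 1 - j : ℕ) : ℤ)
      (NormedSpace.exp (-τ)) * cf ((n : ℤ) - (i + 1 - 1 - j : ℕ)) (NormedSpace.exp τ)) =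
      inner ℂ (uvec τ i) (wvec τ j) * inner ℂ (wvec τ j) (fvec τ (fourier n) i) := by
    intro j hj
    rw [Finset.mem_range] at hj
    rw [inner_uvec_wvec, inner_wvec_fvec, map_mul, Nat.add_sub_cancel, Nat.cast_sub (by omega)]
  rw [Finset.sum_congr rfl this]
  refine hasSum_sum_of_ne_finset_zero fun c hc => ?_
  rw [Finset.mem_range] at hc
  rw [inner_uvec_wvec, cf_eq_zero_of_mem_discAlg (exp_mem_discAlg (neg_mem hτ)) (by omega),
    map_zero, zero_mul]

theorem sum_inner_uvec_starProjection_fvec {τ τ' : C(Circ, ℂ)} (hτ : τ ∈ discAlg)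
    (hτ' : τ' ∈ discAlg) (h : IsCircDeriv τ τ') (n : ℕ) :
    ∑ i ∈ Finset.range n,
      inner ℂ (uvec τ i) ((spanInf (vvec τ)).starProjection (fvec τ (fourier n) i)) =
      starRingEnd ℂ ((n : ℂ) * cf n τ) := by
  simp only [inner_uvec_starProjection_fvec hτ]
  have hn : (n : ℂ) * cf n τ = cf n τ' := by simpa using h n
  rw [← map_sum, hn]
  congr 1
  have h1 : τ' = NormedSpace.exp τ * τ' * NormedSpace.exp (-τ) := by
    rw [mul_right_comm, exp_mul_exp_neg_self, one_mul]
  conv_rhs => rw [h1, cf_mul_of_mem_discAlg (mul_mem (exp_mem_discAlg hτ) hτ')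
    (exp_mem_discAlg (neg_mem hτ))]
  simp only [← h.exp _]
  rw [Finset.sum_range_succ]
  simp only [sub_self, Int.cast_zero, zero_mul, add_zero]
  rw [Finset.sum_comm' (t' := Finset.range n) (s' := fun a => Finset.Ico a n)
    (by simp only [Finset.mem_range, Finset.mem_Ico]; omega)]
  refine Finset.sum_congr rfl fun a ha => ?_
  rw [Finset.mem_range] at ha
  rw [Finset.sum_const, Nat.card_Ico, nsmul_eq_mul, Nat.cast_sub ha.le]
  push_cast
  ring

/-- The trace of the inverse Gram matrix against the matrix of multiplication by `g`, as a
continuous linear functional of `g`. -/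
def trN (τ : C(Circ, ℂ)) (N : ℕ) : C(Circ, ℂ) →L[ℂ] ℂ :=
  ∑ j ∈ Finset.range N, (innerSL ℂ (uvec τ j)).comp
    ((spanN (vvec τ) N).starProjection.comp (toL2.comp
      ((ContinuousLinearMap.mul ℂ C(Circ, ℂ)).flip
        (NormedSpace.exp τ * fourier (-((j : ℤ) + 1))))))

theorem trN_apply (τ g : C(Circ, ℂ)) (N : ℕ) :
    trN τ N g = ∑ j ∈ Finset.range N,
      inner ℂ (uvec τ j) ((spanN (vvec τ) N).starProjection (fvec τ g j)) := by
  simp only [trN, sum_apply]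
  refine Finset.sum_congr rfl fun j _ => ?_
  rw [fvec, mul_assoc]
  rfl

theorem norm_exp_circ_le (f : C(Circ, ℂ)) : ‖NormedSpace.exp f‖ ≤ Real.exp ‖f‖ := by
  have h1 : HasSum (fun n : ℕ => ((n.factorial : ℂ)⁻¹) • f ^ n) (NormedSpace.exp f) :=
    NormedSpace.exp_series_hasSum_exp' (𝕂 := ℂ) f
  have h2 : HasSum (fun n : ℕ => ((n.factorial : ℝ)⁻¹) • ‖f‖ ^ n) (Real.exp ‖f‖) := by
    rw [Real.exp_eq_exp_ℝ]
    exact NormedSpace.exp_series_hasSum_exp' (𝕂 := ℝ) ‖f‖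
  refine h1.norm_le_of_bounded h2 fun n => ?_
  rw [norm_smul, norm_inv, Complex.norm_natCast, smul_eq_mul]
  exact mul_le_mul_of_nonneg_left (norm_pow_le _ _) (by positivity)

theorem norm_uvec_le (τ : C(Circ, ℂ)) (i : ℕ) : ‖uvec τ i‖ ≤ ‖toL2‖ * Real.exp ‖τ‖ := by
  refine (toL2.le_opNorm _).trans (mul_le_mul_of_nonneg_left ?_ (norm_nonneg _))
  refine (norm_mul_le _ _).trans ?_
  rw [fourier_norm, mul_one, norm_star]
  simpa using norm_exp_circ_le (-τ)

theorem norm_fvec_le (τ : C(Circ, ℂ)) (n : ℤ) (i : ℕ) :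
    ‖fvec τ (fourier n) i‖ ≤ ‖toL2‖ * Real.exp ‖τ‖ := by
  refine (toL2.le_opNorm _).trans (mul_le_mul_of_nonneg_left ?_ (norm_nonneg _))
  refine (norm_mul_le _ _).trans ?_
  rw [fourier_norm, mul_one]
  refine (norm_mul_le _ _).trans ?_
  rw [fourier_norm, one_mul]
  exact norm_exp_circ_le τ

theorem trN_fourier (τ : C(Circ, ℂ)) (N : ℕ) {n : ℕ} (hn : 1 ≤ n) :
    trN τ N (fourier n) = ∑ j ∈ Finset.range (min n N),
      inner ℂ (uvec τ j) ((spanN (vvec τ) N).starProjection (fvec τ (fourier n) j)) := by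
  rw [trN_apply]
  symm
  refine Finset.sum_subset (Finset.range_mono (min_le_right _ _)) fun j hj hj' => ?_
  simp only [Finset.mem_range, lt_min_iff, not_and] at hj hj'
  have hnj : n ≤ j := by
    by_contra h
    exact hj' (by omega) hj
  have h1 : fvec τ (fourier n) j = vvec τ (j - n) := by
    rw [fvec, vvec, mul_comm (fourier _), mul_assoc, fourier_mul, Nat.cast_sub hnj]
    congr 3
    ring
  rw [h1, Submodule.starProjection_eq_self_iff.2 (mem_spanN _ (by omega)), inner_uvec_vvec,
    if_neg (by omega)]

theorem norm_trN_fourier_le (τ : C(Circ, ℂ)) (N : ℕ) {n : ℕ} (hn : 1 ≤ n) :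
    ‖trN τ N (fourier n)‖ ≤ n * (‖toL2‖ * Real.exp ‖τ‖) ^ 2 := by
  rw [trN_fourier τ N hn]
  have h0 : 0 ≤ ‖toL2‖ * Real.exp ‖τ‖ := by positivity
  refine (norm_sum_le_of_le (f := fun _ => _) _
    (n := fun _ => (‖toL2‖ * Real.exp ‖τ‖) ^ 2) fun j _ => ?_).trans ?_
  · refine (norm_inner_le_norm _ _).trans ?_
    rw [pow_two]
    refine mul_le_mul (norm_uvec_le τ j) ?_ (norm_nonneg _) h0
    exact (Submodule.norm_starProjection_apply_le _ _).trans (norm_fvec_le τ _ j)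
  · rw [Finset.sum_const, Finset.card_range, nsmul_eq_mul]
    gcongr
    exact min_le_left _ _

theorem tendsto_trN_fourier {τ τ' : C(Circ, ℂ)} (hτ : τ ∈ discAlg)
    (hτ' : τ' ∈ discAlg) (h : IsCircDeriv τ τ') {n : ℕ} (hn : 1 ≤ n) :
    Filter.Tendsto (fun N => trN τ N (fourier n)) .atTop
      (nhds (starRingEnd ℂ ((n : ℂ) * cf n τ))) := by
  rw [← sum_inner_uvec_starProjection_fvec hτ hτ' h]
  have := tendsto_finsetSum (Finset.range n) fun i _ =>
    tendsto_inner_starProjection_spanN (vvec τ) (uvec τ i) (fvec τ (fourier n) i)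
  refine this.congr' ?_
  filter_upwards [Filter.eventually_ge_atTop n] with N hN
  rw [trN_fourier τ N hn, min_eq_left hN]

/-- `τ = ∑ t_n z^n`. -/
def tauC (t : ℕ → ℂ) : C(Circ, ℂ) := ∑' n : ℕ, t n • fourier ((n : ℤ) + 1)

theorem hasSum_tauC {t : ℕ → ℂ} (ht : Summable fun n => ‖t n‖) :
    HasSum (fun n : ℕ => t n • (fourier ((n : ℤ) + 1) : C(Circ, ℂ))) (tauC t) := by
  refine Summable.hasSum (.of_norm ?_)
  simpa only [norm_smul, fourier_norm, mul_one] using ht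

theorem tauC_mem_discAlg {t : ℕ → ℂ} (ht : Summable fun n => ‖t n‖) : tauC t ∈ discAlg := by
  refine isClosed_discAlg.mem_of_tendsto (b := .atTop) (hasSum_tauC ht)
    (Filter.Eventually.of_forall fun s => sum_mem fun n _ => Subalgebra.smul_mem _ ?_ _)
  exact_mod_cast fourier_mem_discAlg (n + 1)

theorem cf_tauC {t : ℕ → ℂ} (ht : Summable fun n => ‖t n‖) (n : ℕ) :
    cf ((n : ℤ) + 1) (tauC t) = t n := by
  refine ((hasSum_tauC ht).mapL (cf ((n : ℤ) + 1))).unique ?_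
  convert! hasSum_ite_eq n (t n) using 2 with k
  rw [map_smul, cf_fourier]
  by_cases h : k = n
  · simp [h]
  · rw [if_neg (by omega), if_neg h, smul_zero]

theorem cf_zero_tauC {t : ℕ → ℂ} (ht : Summable fun n => ‖t n‖) : cf 0 (tauC t) = 0 := by
  refine ((hasSum_tauC ht).mapL (cf 0)).unique ?_
  convert! hasSum_zero using 2 with k
  rw [map_smul, cf_fourier, if_neg (by omega), smul_zero]

theorem isCircDeriv_tauC {t : ℕ → ℂ} (ht : Summable fun n : ℕ => (n + 1 : ℝ) * ‖t n‖)
    (ht' : Summable fun n => ‖t n‖) :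
    IsCircDeriv (tauC t) (tauC fun n => (n + 1) * t n) := by
  refine IsCircDeriv.hasSum (hasSum_tauC ht') (hasSum_tauC (t := fun n => (n + 1) * t n) ?_)
    fun n => ?_
  · refine ht.congr fun n => ?_
    rw [norm_mul]
    congr 1
    exact_mod_cast (Complex.norm_natCast (n + 1)).symm
  · convert! (isCircDeriv_fourier ((n : ℤ) + 1)).const_smul (t n) using 1
    rw [smul_smul, mul_comm (t n)]
    push_cast
    rfl

theorem tendsto_trN_tauC {t : ℕ → ℂ} (ht : Summable fun n : ℕ => (n + 1 : ℝ) * ‖t n‖)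
    (ht' : Summable fun n => ‖t n‖) (r : ℝ) :
    Filter.Tendsto (fun N => trN ((r : ℂ) • tauC t) N (tauC t)) .atTop
      (nhds (r * ((∑' n : ℕ, (n + 1 : ℝ) * ‖t n‖ ^ 2 : ℝ) : ℂ))) := by
  set τ := tauC t
  have hd : IsCircDeriv ((r : ℂ) • τ) ((r : ℂ) • tauC fun n => (n + 1) * t n) :=
    (isCircDeriv_tauC ht ht').const_smul _
  have ht2 : Summable fun n : ℕ => ‖((n : ℂ) + 1) * t n‖ := by
    refine ht.congr fun n => ?_
    rw [norm_mul]
    congr 1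
    exact_mod_cast (Complex.norm_natCast (n + 1)).symm
  have h1 : ∀ N, trN ((r : ℂ) • τ) N τ =
      ∑' n : ℕ, t n * trN ((r : ℂ) • τ) N (fourier ((n + 1 : ℕ) : ℤ)) := fun N => by
    rw [← ((hasSum_tauC ht').mapL (trN ((r : ℂ) • τ) N)).tsum_eq]
    refine tsum_congr fun n => ?_
    rw [map_smul, smul_eq_mul]
    push_cast
    rfl
  simp only [h1]
  have h2 : ((r : ℂ) * ((∑' n : ℕ, (n + 1 : ℝ) * ‖t n‖ ^ 2 : ℝ) : ℂ)) =
      ∑' n : ℕ, t n * starRingEnd ℂ (((n + 1 : ℕ) : ℂ) * cf ((n + 1 : ℕ) : ℤ) ((r : ℂ) • τ)) := by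
    rw [Complex.ofReal_tsum, ← tsum_mul_left]
    refine tsum_congr fun n => ?_
    rw [map_smul, Nat.cast_succ (R := ℤ), cf_tauC ht', smul_eq_mul, map_mul, map_mul,
      Complex.conj_ofReal, map_natCast]
    have := Complex.mul_conj' (t n)
    push_cast
    rw [← this]
    ring
  rw [h2]
  refine tendsto_tsum_of_dominated_convergence
    (bound := fun n => ((n + 1 : ℝ) * ‖t n‖) * (‖toL2‖ * Real.exp ‖(r : ℂ) • τ‖) ^ 2)
    (ht.mul_right _) (fun n => ?_) (Filter.Eventually.of_forall fun N n => ?_)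
  · refine Filter.Tendsto.const_mul _ ?_
    exact tendsto_trN_fourier (Subalgebra.smul_mem _ (tauC_mem_discAlg ht') _)
      (Subalgebra.smul_mem _ (tauC_mem_discAlg ht2) _) hd (Nat.succ_pos n)
  · rw [norm_mul]
    have := norm_trN_fourier_le ((r : ℂ) • τ) N (Nat.succ_pos n)
    push_cast at this ⊢
    calc ‖t n‖ * _ ≤ ‖t n‖ * _ := mul_le_mul_of_nonneg_left this (norm_nonneg _)
      _ = _ := by ring

theorem norm_trN_tauC_le {t : ℕ → ℂ} (ht : Summable fun n : ℕ => (n + 1 : ℝ) * ‖t n‖)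
    (ht' : Summable fun n => ‖t n‖) (τ : C(Circ, ℂ)) (N : ℕ) :
    ‖trN τ N (tauC t)‖ ≤
      (∑' n : ℕ, (n + 1 : ℝ) * ‖t n‖) * (‖toL2‖ * Real.exp ‖τ‖) ^ 2 := by
  rw [← ((hasSum_tauC ht').mapL (trN τ N)).tsum_eq, ← tsum_mul_right]
  refine tsum_of_norm_bounded (ht.mul_right _).hasSum fun n => ?_
  rw [map_smul, norm_smul]
  have := norm_trN_fourier_le τ N (Nat.succ_pos n)
  push_cast at this ⊢
  calc ‖t n‖ * _ ≤ ‖t n‖ * _ := mul_le_mul_of_nonneg_left this (norm_nonneg _)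
    _ = _ := by ring

/-- Jacobi's formula for the derivative of a determinant. -/
theorem hasDerivAt_det {n : Type*} [Fintype n] [DecidableEq n] {A : ℝ → Matrix n n ℂ}
    {A' : Matrix n n ℂ} {r : ℝ} (h : ∀ i j, HasDerivAt (fun s => A s i j) (A' i j) r) :
    HasDerivAt (fun s => (A s).det) ((A r).adjugate * A').trace r := by
  have h1 : HasDerivAt (fun s => (A s).det) (∑ σ : Equiv.Perm n, ((Equiv.Perm.sign σ : ℤ) : ℂ) *
      ∑ i, (∏ j ∈ Finset.univ.erase i, A r (σ j) j) • A' (σ i) i) r := by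
    simp only [Matrix.det_apply']
    exact HasDerivAt.fun_sum fun σ _ => (HasDerivAt.fun_finsetProd fun i _ => h (σ i) i).const_mul _
  convert! h1 using 1
  have h2 : ((A r).adjugate * A').trace = ∑ i, ((A r).updateCol i fun k => A' k i).det := by
    rw [Matrix.trace]
    refine Finset.sum_congr rfl fun i _ => ?_
    rw [← Matrix.cramer_apply, Matrix.cramer_eq_adjugate_mulVec]
    rfl
  rw [h2]
  simp only [Matrix.det_apply', Finset.mul_sum]
  rw [Finset.sum_comm]
  refine Finset.sum_congr rfl fun σ _ => Finset.sum_congr rfl fun i _ => ?_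
  congr 1
  rw [← Finset.prod_erase_mul _ _ (Finset.mem_univ i), Matrix.updateCol_self, smul_eq_mul]
  congr 1
  refine Finset.prod_congr rfl fun j hj => ?_
  rw [Matrix.updateCol_ne (Finset.ne_of_mem_erase hj)]

/-- The Gram matrix of the first `N` vectors `vvec`. -/
def gramN (τ : C(Circ, ℂ)) (N : ℕ) : Matrix (Fin N) (Fin N) ℂ :=
  Matrix.gram ℂ fun j : Fin N => vvec τ j

/-- The compression of multiplication by `g`. -/
def mulN (τ g : C(Circ, ℂ)) (N : ℕ) : Matrix (Fin N) (Fin N) ℂ :=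
  Matrix.of fun i j => inner ℂ (vvec τ i) (fvec τ g j)

theorem inner_vvec_fvec (τ g : C(Circ, ℂ)) (i j : ℕ) :
    inner ℂ (vvec τ i) (fvec τ g j) =
      cf ((j : ℤ) - i) (g * NormedSpace.exp (τ + star τ)) := by
  have h : (fourier (-((j : ℤ) - i)) : C(Circ, ℂ)) =
      fourier ((i : ℤ) + 1) * fourier (-((j : ℤ) + 1)) := by
    rw [fourier_mul]
    congr 1
    ring
  rw [vvec, fvec, inner_toL2, cf_eq ((j : ℤ) - i), h, NormedSpace.exp_add, star_mul, NormedSpace.star_exp,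
    star_fourier, neg_neg]
  congr 1
  ring

theorem star_cf (k : ℤ) (f : C(Circ, ℂ)) : star (cf k f) = cf (-k) (star f) := by
  rw [cf_star, neg_neg]
  rfl

theorem mulN_apply (τ g : C(Circ, ℂ)) (N : ℕ) (i j : Fin N) :
    mulN τ g N i j = cf ((j : ℤ) - i) (g * NormedSpace.exp (τ + star τ)) :=
  inner_vvec_fvec τ g i j

theorem gramN_apply (τ : C(Circ, ℂ)) (N : ℕ) (i j : Fin N) :
    gramN τ N i j = cf ((j : ℤ) - i) (NormedSpace.exp (τ + star τ)) := by
  have h := inner_vvec_fvec τ 1 i j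
  rw [one_mul, fvec, one_mul] at h
  exact h

theorem det_gramN_ne_zero (τ : C(Circ, ℂ)) (N : ℕ) : (gramN τ N).det ≠ 0 :=
  Matrix.det_gram_ne_zero_iff_linearIndependent.2 (linearIndependent_vvec τ N)

theorem trN_eq_trace (τ g : C(Circ, ℂ)) (N : ℕ) :
    trN τ N g = ((gramN τ N)⁻¹ * mulN τ g N).trace := by
  have : (Submodule.span ℂ (Set.range fun j : Fin N => vvec τ j)).HasOrthogonalProjection :=
    inferInstanceAs (spanN (vvec τ) N).HasOrthogonalProjection
  rw [trN_apply, Finset.sum_range, Matrix.trace]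
  refine Finset.sum_congr rfl fun j _ => ?_
  have h := starProjection_span_eq_sum (fun j : Fin N => vvec τ j) (linearIndependent_vvec τ N)
    (fvec τ g j)
  change inner ℂ (uvec τ j) ((Submodule.span ℂ
    (Set.range fun j : Fin N => vvec τ j)).starProjection (fvec τ g j)) = _
  rw [h, inner_sum]
  simp only [inner_smul_right, inner_uvec_vvec, Fin.val_inj, mul_ite, mul_one, mul_zero,
    Finset.sum_ite_eq, Finset.mem_univ, if_true]
  rfl

theorem trN_mul_det (τ g : C(Circ, ℂ)) (N : ℕ) :
    trN τ N g * (gramN τ N).det = ((gramN τ N).adjugate * mulN τ g N).trace := by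
  rw [trN_eq_trace, Matrix.inv_def, Matrix.smul_mul, Matrix.trace_smul, smul_eq_mul,
    Ring.inverse_eq_inv', mul_right_comm, inv_mul_cancel₀ (det_gramN_ne_zero τ N), one_mul]

theorem isHermitian_gramN (τ : C(Circ, ℂ)) (N : ℕ) : (gramN τ N).IsHermitian :=
  Matrix.isHermitian_gram ℂ _

theorem conj_trN (τ g : C(Circ, ℂ)) (N : ℕ) :
    starRingEnd ℂ (trN τ N g) = ((gramN τ N)⁻¹ * (mulN τ g N).conjTranspose).trace := by
  rw [trN_eq_trace, Matrix.trace_mul_comm (gramN τ N)⁻¹ (mulN τ g N).conjTranspose]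
  have := Matrix.trace_conjTranspose ((gramN τ N)⁻¹ * mulN τ g N)
  rw [Matrix.conjTranspose_mul, (isHermitian_gramN τ N).inv.eq] at this
  rw [this]
  rfl

theorem hasDerivAt_det_gramN (τ : C(Circ, ℂ)) (N : ℕ) (r : ℝ) :
    HasDerivAt (fun s : ℝ => (gramN ((s : ℂ) • τ) N).det)
      ((trN ((r : ℂ) • τ) N τ + starRingEnd ℂ (trN ((r : ℂ) • τ) N τ)) *
        (gramN ((r : ℂ) • τ) N).det) r := by
  have hψ : ∀ s : ℝ, (s : ℂ) • τ + star ((s : ℂ) • τ) = (s : ℂ) • (τ + star τ) := fun s => by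
    rw [star_smul, smul_add]
    congr 2
    exact Complex.conj_ofReal s
  have h : ∀ i j, HasDerivAt (fun s : ℝ => gramN ((s : ℂ) • τ) N i j)
      ((mulN ((r : ℂ) • τ) τ N + (mulN ((r : ℂ) • τ) τ N).conjTranspose) i j) r := by
    intro i j
    simp only [gramN_apply, hψ]
    have h1 := (hasDerivAt_exp_smul_const (𝕂 := ℂ) (τ + star τ) (r : ℂ))
    have h2 := ((cf ((j : ℤ) - i)).hasFDerivAt.comp_hasDerivAt (r : ℂ) h1).comp_ofReal
    convert! h2 using 1
    rw [Matrix.add_apply, Matrix.conjTranspose_apply, mulN_apply, mulN_apply, hψ, star_cf, neg_sub,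
      ← map_add]
    congr 1
    rw [star_mul, NormedSpace.star_exp, star_smul, star_add, star_star, add_comm (star τ),
      show star (r : ℂ) = r from Complex.conj_ofReal r]
    ring
  convert! hasDerivAt_det h using 1
  rw [trN_eq_trace, ← trN_eq_trace, conj_trN, trN_eq_trace, ← Matrix.trace_add, ← Matrix.mul_add,
    Matrix.inv_def, Matrix.smul_mul, Matrix.trace_smul, smul_eq_mul,
    Ring.inverse_eq_inv', mul_right_comm, inv_mul_cancel₀ (det_gramN_ne_zero _ N), one_mul]

theorem continuous_trN (τ : C(Circ, ℂ)) (N : ℕ) :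
    Continuous fun r : ℝ => trN ((r : ℂ) • τ) N τ := by
  have hexp : Continuous (NormedSpace.exp : C(Circ, ℂ) → C(Circ, ℂ)) :=
    NormedSpace.exp_continuous
  have h0 : Continuous fun r : ℝ => NormedSpace.exp ((r : ℂ) • τ + star ((r : ℂ) • τ)) := by
    refine hexp.comp ?_
    have : Continuous fun r : ℝ => (r : ℂ) • τ := Complex.continuous_ofReal.smul continuous_const
    exact this.add (continuous_star.comp this)
  have h1 : Continuous fun r : ℝ => gramN ((r : ℂ) • τ) N := by
    refine continuous_matrix fun i j => ?_
    simp only [gramN_apply]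
    exact (cf _).continuous.comp h0
  have h2 : Continuous fun r : ℝ => mulN ((r : ℂ) • τ) τ N := by
    refine continuous_matrix fun i j => ?_
    simp only [mulN_apply]
    exact (cf _).continuous.comp (continuous_const.mul h0)
  have h3 : ∀ r : ℝ, trN ((r : ℂ) • τ) N τ = ((gramN ((r : ℂ) • τ) N).adjugate *
      mulN ((r : ℂ) • τ) τ N).trace / (gramN ((r : ℂ) • τ) N).det := fun r => by
    rw [← trN_mul_det, mul_div_cancel_right₀ _ (det_gramN_ne_zero _ _)]
  simp only [h3]
  exact ((h1.matrix_adjugate.matrix_mul h2).matrix_trace).div h1.matrix_det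
    fun r => det_gramN_ne_zero _ _

theorem det_gramN_zero (N : ℕ) : (gramN 0 N).det = 1 := by
  have : gramN 0 N = 1 := by
    ext i j
    rw [gramN_apply, star_zero, add_zero, NormedSpace.exp_zero, ← fourier_zero_eq_one, cf_fourier,
      Matrix.one_apply]
    congr 1
    rw [sub_eq_zero, Nat.cast_inj, Fin.val_inj]
    exact propext eq_comm
  rw [this, Matrix.det_one]

theorem det_gramN_eq_exp (τ : C(Circ, ℂ)) (N : ℕ) :
    (gramN τ N).det = Complex.exp (∫ r in (0 : ℝ)..1,
      (trN ((r : ℂ) • τ) N τ + starRingEnd ℂ (trN ((r : ℂ) • τ) N τ))) := by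
  set φ : ℝ → ℂ := fun r => trN ((r : ℂ) • τ) N τ + starRingEnd ℂ (trN ((r : ℂ) • τ) N τ) with hφ
  have hc : Continuous φ :=
    (continuous_trN τ N).add (Complex.continuous_conj.comp (continuous_trN τ N))
  let L : ℝ → ℂ := fun s => ∫ r in (0 : ℝ)..s, φ r
  have hL : ∀ s, HasDerivAt L (φ s) s := fun s => hc.integral_hasStrictDerivAt 0 s |>.hasDerivAt
  let F : ℝ → ℂ := fun s => (gramN ((s : ℂ) • τ) N).det * Complex.exp (-L s)
  have hF : ∀ s, HasDerivAt F 0 s := fun s => by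
    convert! (hasDerivAt_det_gramN τ N s).mul (hL s).neg.cexp using 1
    simp only [hφ]
    ring
  have h01 : F 1 = F 0 :=
    is_const_of_deriv_eq_zero (fun s => (hF s).differentiableAt) (fun s => (hF s).deriv) 1 0
  have h0 : F 0 = 1 := by
    simp only [F, L, intervalIntegral.integral_same, Complex.ofReal_zero, zero_smul,
      det_gramN_zero, neg_zero, Complex.exp_zero, mul_one]
  have h1 : F 1 = (gramN τ N).det * Complex.exp (-L 1) := by
    simp only [F, Complex.ofReal_one, one_smul]
  rw [h0, h1, Complex.exp_neg, mul_inv_eq_one₀ (Complex.exp_ne_zero _)] at h01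
  exact h01

/-- The strong Szegő limit theorem. -/
theorem tendsto_det_gramN {t : ℕ → ℂ} (ht : Summable fun n : ℕ => (n + 1 : ℝ) * ‖t n‖)
    (ht' : Summable fun n => ‖t n‖) :
    Filter.Tendsto (fun N => (gramN (tauC t) N).det) .atTop
      (nhds (Real.exp (∑' n : ℕ, (n + 1 : ℝ) * ‖t n‖ ^ 2) : ℂ)) := by
  set τ := tauC t
  set S : ℝ := ∑' n : ℕ, (n + 1 : ℝ) * ‖t n‖ ^ 2
  simp only [det_gramN_eq_exp]
  rw [Complex.ofReal_exp]
  refine (Complex.continuous_exp.tendsto _).comp ?_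
  have hS : (S : ℂ) = ∫ r in (0 : ℝ)..1, ((r * S : ℂ) + starRingEnd ℂ (r * S : ℂ)) := by
    have : ∀ r : ℝ, ((r * S : ℂ) + starRingEnd ℂ (r * S : ℂ)) = ((r * (2 * S) : ℝ) : ℂ) :=
      fun r => by
        rw [map_mul, Complex.conj_ofReal, Complex.conj_ofReal]
        push_cast
        ring
    simp only [this]
    rw [intervalIntegral.integral_ofReal, intervalIntegral.integral_mul_const, integral_id]
    norm_num
    ring
  rw [hS]
  have hb : ∀ (N : ℕ) (r : ℝ), r ∈ Set.uIoc (0 : ℝ) 1 → ‖trN ((r : ℂ) • τ) N τ‖ ≤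
      (∑' n : ℕ, (n + 1 : ℝ) * ‖t n‖) * (‖toL2‖ * Real.exp ‖τ‖) ^ 2 := by
    intro N r hr
    rw [Set.uIoc_of_le zero_le_one] at hr
    refine (norm_trN_tauC_le ht ht' _ N).trans ?_
    have h1 : ‖(r : ℂ) • τ‖ ≤ ‖τ‖ := by
      rw [norm_smul, Complex.norm_real, Real.norm_of_nonneg hr.1.le]
      exact mul_le_of_le_one_left (norm_nonneg _) hr.2
    have h2 : 0 ≤ ∑' n : ℕ, (n + 1 : ℝ) * ‖t n‖ := tsum_nonneg fun n => by positivity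
    gcongr
  refine intervalIntegral.tendsto_integral_filter_of_dominated_convergence
    (fun _ => 2 * ((∑' n : ℕ, (n + 1 : ℝ) * ‖t n‖) * (‖toL2‖ * Real.exp ‖τ‖) ^ 2))
    (Filter.Eventually.of_forall fun N => ?_) (Filter.Eventually.of_forall fun N => ?_)
    intervalIntegrable_const ?_
  · exact ((continuous_trN τ N).add
      (Complex.continuous_conj.comp (continuous_trN τ N))).aestronglyMeasurable
  · refine Filter.Eventually.of_forall fun r hr => (norm_add_le _ _).trans ?_
    rw [RCLike.norm_conj, ← two_mul]
    exact mul_le_mul_of_nonneg_left (hb N r hr) zero_le_two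
  · refine Filter.Eventually.of_forall fun r _ => ?_
    have h := tendsto_trN_tauC ht ht' r
    exact h.add ((Complex.continuous_conj.tendsto _).comp h)

theorem exp_apply (f : C(Circ, ℂ)) (x : Circ) : (NormedSpace.exp f) x = Complex.exp (f x) := by
  have h1 : HasSum (fun n : ℕ => ((n.factorial : ℂ)⁻¹) • f ^ n) (NormedSpace.exp f) :=
    NormedSpace.exp_series_hasSum_exp' (𝕂 := ℂ) f
  have h2 : HasSum (fun n : ℕ => ((n.factorial : ℂ)⁻¹) • f x ^ n) (Complex.exp (f x)) := by
    rw [Complex.exp_eq_exp_ℂ]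
    exact NormedSpace.exp_series_hasSum_exp' (𝕂 := ℂ) (f x)
  exact (h1.mapL (ContinuousMap.evalCLM ℂ x)).unique h2

theorem fourier_coe_eq_pow (n : ℕ) (θ : ℝ) :
    (fourier ((n : ℤ) + 1) : C(Circ, ℂ)) (θ : Circ) = Complex.exp (θ * Complex.I) ^ (n + 1) := by
  rw [fourier_coe_apply, ← Complex.exp_nat_mul]
  congr 1
  have : (Real.pi : ℂ) ≠ 0 := by exact_mod_cast Real.pi_ne_zero
  push_cast
  field_simp

theorem hasSum_tauC_apply {t : ℕ → ℂ} (ht : Summable fun n => ‖t n‖) (θ : ℝ) :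
    HasSum (fun n => t n * Complex.exp (θ * Complex.I) ^ (n + 1)) (tauC t (θ : Circ)) := by
  simp only [← fourier_coe_eq_pow]
  exact (hasSum_tauC ht).mapL (ContinuousMap.evalCLM ℂ (θ : Circ))

theorem hcoef_eq_cf {t : ℕ → ℂ} (ht : Summable fun n => ‖t n‖) (k : ℤ) :
    hcoef t k = cf k (NormedSpace.exp (tauC t)) := by
  rw [hcoef]
  split_ifs with hk
  · exact (cf_eq_zero_of_mem_discAlg (exp_mem_discAlg (tauC_mem_discAlg ht)) hk).symm
  · rw [cf_eq_integral]
    congr 1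
    refine intervalIntegral.integral_congr fun θ _ => ?_
    simp only [gammaFn]
    rw [exp_apply, (hasSum_tauC_apply ht θ).tsum_eq]

theorem hcoef_zero {t : ℕ → ℂ} (ht : Summable fun n => ‖t n‖) : hcoef t 0 = 1 := by
  rw [hcoef_eq_cf ht, cf_zero_exp (tauC_mem_discAlg ht), cf_zero_tauC ht, NormedSpace.exp_zero]

theorem Jcoef_eq_cf {t : ℕ → ℂ} (ht : Summable fun n => ‖t n‖) (k : ℤ) :
    Jcoef t (fun n => starRingEnd ℂ (t n)) k =
      cf k (NormedSpace.exp (tauC t - star (tauC t))) := by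
  rw [Jcoef, cf_eq_integral]
  congr 1
  refine intervalIntegral.integral_congr fun θ _ => ?_
  simp only [Jfun]
  rw [exp_apply]
  congr 2
  have h1 := hasSum_tauC_apply ht θ
  have h2 := (Complex.hasSum_conj'.2 h1 : HasSum _ _)
  have h3 : (Complex.exp (θ * Complex.I))⁻¹ = starRingEnd ℂ (Complex.exp (θ * Complex.I)) := by
    rw [← Complex.exp_neg, ← Complex.exp_conj]
    simp
  refine (h1.sub ?_).tsum_eq
  rw [h3]
  simp only [map_mul, map_pow] at h2
  exact h2

theorem Jcoef_neg_eq {t : ℕ → ℂ} (ht : Summable fun n => ‖t n‖) (k : ℤ) :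
    Jcoef (-t) (-fun n => starRingEnd ℂ (t n)) (-k) =
      starRingEnd ℂ (cf k (NormedSpace.exp (tauC t - star (tauC t)))) := by
  have h1 : (-fun n => starRingEnd ℂ (t n)) = fun n => starRingEnd ℂ ((-t) n) := by
    funext n
    simp
  have h2 : tauC (-t) = -tauC t := by
    simp only [tauC, Pi.neg_apply, neg_smul]
    exact tsum_neg
  have h3 := cf_star (-k) (NormedSpace.exp (tauC t - star (tauC t)))
  rw [neg_neg] at h3
  rw [h1, Jcoef_eq_cf (by simpa using ht), ← h3, NormedSpace.star_exp, h2]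
  congr 2
  rw [star_sub, star_star, star_neg]
  abel

theorem Kker_eq_inner {t : ℕ → ℂ} (ht : Summable fun n => ‖t n‖) (a b : ℤ) :
    Kker t (fun n => starRingEnd ℂ (t n)) posInd a b =
      inner ℂ (toL2 (fourier a))
        ((spanInf (vvec (tauC t))).starProjection (toL2 (fourier b))) := by
  have h := hasSum_inner_wvec (orthonormal_wvec (tauC t)) (toL2 (fourier a)) (toL2 (fourier b))
  rw [starProjection_congr (spanInf_wvec (tauC_mem_discAlg ht))] at h
  rw [← h.tsum_eq, Kker]
  simp only [Jcoef_neg_eq ht, Jcoef_eq_cf ht]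
  have hw : ∀ (k : ℤ) (c : ℕ), inner ℂ (toL2 (fourier k)) (wvec (tauC t) c) =
      cf (k + c + 1) (NormedSpace.exp (tauC t - star (tauC t))) := fun k c => by
    rw [wvec, inner_fourier_toL2, mul_comm (NormedSpace.exp _), cf_fourier_mul]
    congr 1
    congr 1
    ring
  rw [← Function.Injective.tsum_eq (Nat.cast_injective (R := ℤ))]
  · refine tsum_congr fun c => ?_
    rw [hw, ← inner_conj_symm (wvec (tauC t) c), hw, posInd, if_pos (Int.natCast_nonneg c),
      Complex.ofReal_one, one_mul]
  · intro c hc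
    by_contra h'
    refine hc ?_
    have : ¬ 0 ≤ c := fun h0 => h' ⟨c.toNat, by simp [h0]⟩
    have h0 : posInd c = 0 := if_neg this
    simp only [h0, Complex.ofReal_zero, zero_mul]

theorem inner_fourier_vvec {t : ℕ → ℂ} (ht : Summable fun n => ‖t n‖) (s : ℤ) (j : ℕ) :
    inner ℂ (toL2 (fourier s)) (vvec (tauC t) j) = hcoef t (s + j + 1) := by
  rw [vvec, inner_fourier_toL2, mul_comm (NormedSpace.exp _), cf_fourier_mul, hcoef_eq_cf ht]
  congr 1
  congr 1
  ring

theorem hcoef_of_neg (t : ℕ → ℂ) {k : ℤ} (hk : k < 0) : hcoef t k = 0 := if_pos hk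

theorem summable_norm_of_RSummable {R : ℝ} (hR : 1 < R) {t : ℕ → ℂ} (ht : RSummable R t) :
    (Summable fun n : ℕ => (n + 1 : ℝ) * ‖t n‖) ∧ Summable fun n => ‖t n‖ := by
  have h1 : Summable fun n : ℕ => (n + 1 : ℝ) * ‖t n‖ := by
    have hb := one_add_mul_le_pow (show (-2 : ℝ) ≤ R - 1 by linarith)
    refine .of_nonneg_of_le (fun n => by positivity) (fun n => ?_)
      (ht.mul_right (R - 1)⁻¹)
    have h := hb (n + 1)
    have h' : (0 : ℝ) < R - 1 := by linarith
    rw [add_sub_cancel] at h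
    push_cast at h
    rw [← div_eq_mul_inv, le_div_iff₀ h', mul_right_comm, mul_comm]
    refine mul_le_mul_of_nonneg_left ?_ (norm_nonneg _)
    linarith
  refine ⟨h1, .of_nonneg_of_le (fun n => norm_nonneg _) (fun n => ?_) h1⟩
  nlinarith [norm_nonneg (t n), (Nat.cast_nonneg n : (0 : ℝ) ≤ n)]

theorem coe_fourierBasis_apply (s : ℤ) :
    (fourierBasis (T := 2 * Real.pi)) s = toL2 (fourier s) := by
  rw [coe_fourierBasis]
  rfl

theorem Partition'.mem_range_points_iff (lam : Partition') {N : ℕ} (hN : lam.len ≤ N) {a : ℤ}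
    (ha : -(N : ℤ) ≤ a) : a ∈ Set.range (lam.points N) ↔ a ∈ S0 lam := by
  constructor
  · rintro ⟨i, rfl⟩
    exact ⟨i, rfl⟩
  · rintro ⟨i, rfl⟩
    have hi : i < N := by
      by_contra! hi
      rw [lam.part_eq_zero_iff.2 (hN.trans hi)] at ha
      push_cast at ha
      omega
    exact ⟨⟨i, hi⟩, rfl⟩

open Classical in
/-- Correlations of the Schur weights restricted to partitions with at most `N` parts. -/
theorem hasSum_partition_len_le {t : ℕ → ℂ} (ht : Summable fun n => ‖t n‖) {m : ℕ}
    {x : Fin m → ℤ} (hx : Function.Injective x) {N : ℕ} (hN : ∀ a, -(N : ℤ) ≤ x a) :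
    HasSum (fun lam : Partition' => ((if lam.len ≤ N then
        ‖schurPoly t lam‖ ^ 2 * (if ∀ a, x a ∈ S0 lam then 1 else 0) else 0 : ℝ) : ℂ))
      ((gramN (tauC t) N).det * Matrix.det (Matrix.of fun a b =>
        inner ℂ (toL2 (fourier (x a)))
          ((spanN (vvec (tauC t)) N).starProjection (toL2 (fourier (x b)))))) := by
  have : (Submodule.span ℂ (Set.range fun j : Fin N => vvec (tauC t) j)).HasOrthogonalProjection :=
    inferInstanceAs (spanN (vvec (tauC t)) N).HasOrthogonalProjection
  have h := hasSum_norm_det_sq_of_subset fourierBasis (fun j : Fin N => vvec (tauC t) j)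
    (linearIndependent_vvec (tauC t) N) x hx
  simp only [coe_fourierBasis_apply, inner_fourier_vvec ht] at h
  have hp := hasSum_partition_of_hasSum_tuple h (fun s σ => ?_) (fun s hs => ?_)
  · refine (congrArg (HasSum · _) (funext fun lam => ?_)).mpr hp
    by_cases hl : lam.len ≤ N
    · have h1 : schurPoly t lam =
          Matrix.det (Matrix.of fun i j : Fin N => hcoef t (lam.points N i + j + 1)) := by
        rw [schurPoly_eq_det_of_len_le (hcoef_zero ht) lam hl]
        congr! 4 with i j
        rw [Partition'.points]
        congr 1
        ring
      have h2 : (∀ a, x a ∈ Set.range (lam.points N)) ↔ ∀ a, x a ∈ S0 lam :=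
        forall_congr' fun a => lam.mem_range_points_iff hl (hN a)
      simp only [if_pos hl, h1, h2]
    · simp only [if_neg hl, Complex.ofReal_zero]
  · have h1 : Matrix.of (fun i j : Fin N => hcoef t ((s ∘ σ) i + j + 1)) =
        (Matrix.of fun i j : Fin N => hcoef t (s i + j + 1)).submatrix σ id := rfl
    rw [h1, Matrix.det_permute, norm_mul]
    simp only [σ.surjective.range_comp s]
    rcases Int.units_eq_one_or (Equiv.Perm.sign σ) with h2 | h2 <;> simp [h2]
  · have hdet : Matrix.det (Matrix.of fun i j : Fin N => hcoef t (s i + j + 1)) ≠ 0 := by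
      rintro h0
      simp [h0] at hs
    refine ⟨fun i j hij => ?_, fun i => ?_⟩
    · by_contra hne
      exact hdet (Matrix.det_zero_of_row_eq hne (by funext k; simp [hij]))
    · by_contra! hi
      refine hdet (Matrix.det_eq_zero_of_row_eq_zero i fun j => ?_)
      exact hcoef_of_neg t (by have := j.2; omega)

/-- If the sums of a nonnegative function over the sets `len ≤ N` converge as `N → ∞`, then the
function is summable and its sum is the limit. -/
theorem hasSum_of_tendsto_filtration {Λ : Type*} {g : Λ → ℝ} (hg : ∀ l, 0 ≤ g l) (len : Λ → ℕ)
    {a : ℕ → ℂ} {A : ℂ} {N₀ : ℕ}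
    (ha : ∀ N ≥ N₀, HasSum (fun l => ((if len l ≤ N then g l else 0 : ℝ) : ℂ)) (a N))
    (hA : Filter.Tendsto a Filter.atTop (nhds A)) :
    Summable g ∧ ((∑' l, g l : ℝ) : ℂ) = A := by
  have hre : ∀ N ≥ N₀, HasSum (fun l => if len l ≤ N then g l else 0) (a N).re := fun N hN => by
    simpa using Complex.hasSum_re (ha N hN)
  have hsum : Summable g := by
    refine summable_of_sum_le hg (c := A.re) fun u => ?_
    refine ge_of_tendsto ((Complex.continuous_re.tendsto A).comp hA) ?_
    filter_upwards [Filter.eventually_ge_atTop (max N₀ (u.sup len))] with N hN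
    have h1 := sum_le_hasSum u (fun l _ => by split_ifs <;> simp [hg])
      (hre N (le_of_max_le_left hN))
    refine le_trans (Finset.sum_le_sum fun l hl => ?_) h1
    rw [if_pos ((Finset.le_sup hl).trans (le_of_max_le_right hN))]
  refine ⟨hsum, ?_⟩
  have h2 : Filter.Tendsto (fun N => ∑' l, if len l ≤ N then g l else 0) Filter.atTop
      (nhds (∑' l, g l)) := by
    refine tendsto_tsum_of_dominated_convergence hsum (fun l => ?_) (.of_forall fun N l => ?_)
    · refine tendsto_const_nhds.congr' ?_
      filter_upwards [Filter.eventually_ge_atTop (len l)] with N hN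
      rw [if_pos hN]
    · split_ifs
      · rw [Real.norm_of_nonneg (hg l)]
      · simpa using hg l
  refine tendsto_nhds_unique ((Complex.continuous_ofReal.tendsto _).comp h2) (hA.congr' ?_)
  filter_upwards [Filter.eventually_ge_atTop N₀] with N hN
  rw [Function.comp, Complex.ofReal_tsum]
  exact (ha N hN).tsum_eq.symm

attribute [local instance] Classical.propDecidable

/-- correlation functions of the Schur measure. For a finite set
`X = {x_1, …, x_m} ⊂ ℤ'` (encoded by an injective `x : Fin m → ℤ`, `a ↦ a + 1/2`),
`∑_λ |s_λ(t)|² 1_{X ⊆ S_0(λ)} = exp (∑ n |t_n|²) det (K_{t,t̄}(x_i,x_j))`,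
the family being summable. -/
theorem schur_measure_correlations (R : ℝ) (hR : 1 < R) (t : ℕ → ℂ)
    (ht : RSummable R t) (m : ℕ) (x : Fin m → ℤ) (hx : Function.Injective x) :
    (Summable fun lam : Partition' =>
        ‖schurPoly t lam‖ ^ 2 * (if ∀ i, x i ∈ S0 lam then (1:ℝ) else 0)) ∧
      ((∑' lam : Partition',
          ‖schurPoly t lam‖ ^ 2 * (if ∀ i, x i ∈ S0 lam then (1:ℝ) else 0) : ℝ) : ℂ)
        = Real.exp (∑' n : ℕ, (n + 1 : ℝ) * ‖t n‖ ^ 2) *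
            Matrix.det (Matrix.of fun i j : Fin m =>
              Kker t (fun n => (starRingEnd ℂ) (t n)) posInd (x i) (x j)) := by
  obtain ⟨h1, h2⟩ := summable_norm_of_RSummable hR ht
  have h3 : Filter.Tendsto (fun N => Matrix.det (Matrix.of fun i j : Fin m =>
        inner ℂ (toL2 (fourier (x i)))
          ((spanN (vvec (tauC t)) N).starProjection (toL2 (fourier (x j)))))) Filter.atTop
      (nhds (Matrix.det (Matrix.of fun i j : Fin m =>
        Kker t (fun n => (starRingEnd ℂ) (t n)) posInd (x i) (x j)))) := by
    refine ((continuous_id.matrix_det).tendsto _).comp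
      (tendsto_pi_nhds.2 fun i => tendsto_pi_nhds.2 fun j => ?_)
    simp only [Matrix.of_apply, Kker_eq_inner h2]
    exact tendsto_inner_starProjection_spanN _ _ _
  refine hasSum_of_tendsto_filtration (fun lam => by positivity) Partition'.len
    (N₀ := Finset.univ.sup fun i => (-x i).toNat)
    (fun N hN => ?_) ((tendsto_det_gramN h1 h2).mul h3)
  have h4 : ∀ a, -(N : ℤ) ≤ x a := fun a => by
    have := (Finset.le_sup (f := fun i => (-x i).toNat) (Finset.mem_univ a)).trans hN
    omega
  convert hasSum_partition_len_le h2 hx h4 using 1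

end
end

section
/- Let R > 1 and let t be an R-summable sequence of complex numbers. Then the family (|s_λ(t)|²)_λ, indexed by all Young diagrams λ, is summable with sum Σ_λ |s_λ(t)|² = exp(Σ_{n≥1} n |t_n|²). (This is the specialized Cauchy identity guaranteeing that the Schur measure λ ↦ exp(−Σ n|t_n|²)|s_λ(t)|² is a probability measure on the set of Young diagrams.) -/
open scoped BigOperators

noncomputable section

open PowerSeries in
theorem PowerSeries.derivative_finset_prod {K ι : Type*} [CommRing K] [DecidableEq ι]
    (s : Finset ι) (f : ι → K⟦X⟧) :
    d⁄dX K (∏ i ∈ s, f i) = ∑ i ∈ s, ∏ j ∈ s, Function.update f i (d⁄dX K (f i)) j := by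
  induction s using Finset.induction_on with
  | empty => simp
  | insert a s ha ih =>
    rw [Finset.prod_insert ha, Derivation.leibniz, ih, Finset.sum_insert ha,
      Finset.prod_insert ha, smul_eq_mul, smul_eq_mul, Finset.mul_sum, add_comm]
    congr 1
    · rw [Function.update_self, mul_comm]
      congr 1
      exact Finset.prod_congr rfl fun j hj => by
        rw [Function.update_of_ne (ne_of_mem_of_not_mem hj ha)]
    · refine Finset.sum_congr rfl fun i hi => ?_
      rw [Finset.prod_insert ha, Function.update_of_ne (ne_of_mem_of_not_mem hi ha).symm]

open PowerSeries in
/-- Jacobi's formula: a solution of `M' = G M` satisfies `(det M)' = tr G * det M`. -/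
theorem PowerSeries.derivative_det {K n : Type*} [CommRing K] [DecidableEq n] [Fintype n]
    (M G : Matrix n n K⟦X⟧) (h : M.map (d⁄dX K) = G * M) :
    d⁄dX K M.det = G.trace * M.det := by
  have h1 : d⁄dX K M.det
      = ∑ i, (M.updateRow i (∑ k, G i k • M k)).det := by
    have hrow (i : n) : (∑ k, G i k • M k) = fun j => d⁄dX K (M i j) := by
      funext j
      have := congrFun (congrFun h i) j
      simp only [Matrix.map_apply, Matrix.mul_apply] at this
      simp [this]
    simp only [hrow]
    simp only [Matrix.det_apply, map_sum]
    rw [Finset.sum_comm]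
    refine Finset.sum_congr rfl fun σ _ => ?_
    rw [map_zsmul_unit, PowerSeries.derivative_finset_prod, ← Finset.smul_sum]
    congr 1
    rw [← Equiv.sum_comp σ fun i => ∏ j, (M.updateRow i fun k => d⁄dX K (M i k)) (σ j) j]
    refine Finset.sum_congr rfl fun i _ => Finset.prod_congr rfl fun j _ => ?_
    obtain rfl | hij := eq_or_ne j i
    · rw [Function.update_self, Matrix.updateRow_self]
    · rw [Function.update_of_ne hij, Matrix.updateRow_ne (fun h => hij (σ.injective h))]
  rw [h1]
  simp only [Matrix.det_updateRow_sum, smul_eq_mul, ← Finset.sum_mul]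
  rfl

theorem Matrix.det_mul_transpose_eq_sum_orderEmb {R ι : Type*} [CommRing R] [Fintype ι]
    [LinearOrder ι] {N : ℕ} (B A : Matrix (Fin N) ι R) :
    (B * A.transpose).det =
      ∑ s : Fin N ↪o ι, (B.submatrix id s).det * (A.submatrix id s).det := by
  have h1 : (B * A.transpose).det
      = ∑ f : Fin N → ι, (∏ j, A j (f j)) * (B.submatrix id f).det := by
    rw [← Matrix.det_transpose]
    have : (B * A.transpose).transpose = fun j => ∑ l, A j l • (fun i => B i l) := by
      funext j i
      simp [Matrix.mul_apply, mul_comm]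
    rw [this]
    change Matrix.detRowAlternating.toMultilinearMap _ = _
    rw [MultilinearMap.map_sum]
    refine Finset.sum_congr rfl fun f _ => ?_
    rw [MultilinearMap.map_smul_univ, smul_eq_mul, ← Matrix.det_transpose]
    rfl
  rw [h1]
  have h2 : ∀ s : Fin N ↪o ι, (B.submatrix id s).det * (A.submatrix id s).det
      = ∑ σ : Equiv.Perm (Fin N), (∏ j, A j (s (σ j))) * (B.submatrix id (s ∘ σ)).det := by
    intro s
    rw [← Matrix.det_transpose (A.submatrix id s), Matrix.det_apply' (Matrix.transpose _),
      Finset.mul_sum]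
    refine Finset.sum_congr rfl fun σ _ => ?_
    have : B.submatrix id (s ∘ σ) = (B.submatrix id s).submatrix id σ := rfl
    rw [this, Matrix.det_permute']
    simp
    ring
  simp only [h2]
  rw [← Finset.sum_product' (s := Finset.univ) (t := Finset.univ)
    (f := fun (s : Fin N ↪o ι) (σ : Equiv.Perm (Fin N)) =>
      (∏ j, A j (s (σ j))) * (B.submatrix id (s ∘ σ)).det)]
  symm
  refine Finset.sum_of_injOn (fun p : (Fin N ↪o ι) × Equiv.Perm (Fin N) => p.1 ∘ p.2)
    ?_ (by simp) ?_ (fun _ _ => rfl)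
  · rintro ⟨s, σ⟩ - ⟨s', σ'⟩ - h
    simp only at h
    have hr : Set.range s = Set.range s' := by
      rw [← EquivLike.range_comp s σ, ← EquivLike.range_comp s' σ', h]
    have hs : s = s' := by
      ext1 x
      exact congrFun ((StrictMono.range_inj s.strictMono s'.strictMono).1 hr) x
    subst hs
    congr 1
    ext1 x
    exact s.injective (congrFun h x)
  · intro f _ hf
    by_cases hi : Function.Injective f
    · refine absurd ?_ hf
      have hm : StrictMono (f ∘ Tuple.sort f) :=
        (Tuple.monotone_sort f).strictMono_of_injective (hi.comp (Tuple.sort f).injective)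
      refine ⟨(OrderEmbedding.ofStrictMono _ hm, (Tuple.sort f)⁻¹), by simp, ?_⟩
      funext x
      simp
    · simp only [Function.Injective, not_forall] at hi
      obtain ⟨a, b, hab, hne⟩ := hi
      rw [Matrix.det_zero_of_column_eq hne (by simp [hab]), mul_zero]

section Companion

open PowerSeries

variable {K : Type*} [CommRing K] {N : ℕ}

/-- The matrix `f(X • C)` obtained by substituting `X • C` into the power series `f`. -/
def matrixSubst {n : Type*} [Fintype n] [DecidableEq n] (C : Matrix n n K) (f : K⟦X⟧) :
    Matrix n n K⟦X⟧ :=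
  Matrix.of fun i j => PowerSeries.mk fun m => coeff m f * (C ^ m) i j

theorem derivative_det_matrixSubst {n : Type*} [Fintype n] [DecidableEq n] (C : Matrix n n K)
    (f F : K⟦X⟧) (hf : d⁄dX K f = F * f) :
    d⁄dX K (matrixSubst C f).det
      = (PowerSeries.mk fun m => coeff m F * (C ^ (m + 1)).trace) * (matrixSubst C f).det := by
  rw [PowerSeries.derivative_det _
    (Matrix.of fun i j => PowerSeries.mk fun m => coeff m F * (C ^ (m + 1)) i j)]
  · congr 1
    ext m
    simp [Matrix.trace, Finset.mul_sum]
  · ext i j m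
    have h := congrArg (coeff m) hf
    rw [coeff_derivative, coeff_mul] at h
    simp only [matrixSubst, Matrix.map_apply, Matrix.of_apply, coeff_derivative, coeff_mk,
      Matrix.mul_apply, map_sum, coeff_mul]
    rw [mul_right_comm, h, Finset.sum_mul, Finset.sum_comm]
    refine Finset.sum_congr rfl fun p hp => ?_
    rw [Finset.HasAntidiagonal.mem_antidiagonal] at hp
    have : m + 1 = (p.1 + 1) + p.2 := by omega
    rw [this, pow_add, Matrix.mul_apply, Finset.mul_sum]
    exact Finset.sum_congr rfl fun k _ => by ring

/-- The companion matrix of `P`, of size `N + 1`. -/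
def companionMatrix (N : ℕ) (P : K⟦X⟧) : Matrix (Fin (N + 1)) (Fin (N + 1)) K :=
  Matrix.of fun i j => if i = 0 then -coeff (j + 1) P else if (i : ℕ) = j + 1 then 1 else 0

/-- The coefficients of `q`, shifted by `i` and extended by zero. -/
def shiftCoeff (q : K⟦X⟧) (l i : ℕ) : K := if i ≤ l then coeff (l - i) q else 0

theorem companionMatrix_mulVec {P q : K⟦X⟧} (hPq : P * q = 1) (hP0 : coeff 0 P = 1)
    (hP : ∀ k, N + 1 < k → coeff k P = 0) (l : ℕ) :
    (companionMatrix N P).mulVec (fun i : Fin (N + 1) => shiftCoeff q l i)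
      = fun i : Fin (N + 1) => shiftCoeff q (l + 1) i := by
  funext i
  obtain rfl | ⟨i, rfl⟩ := Fin.eq_zero_or_eq_succ i
  · have h := congrArg (coeff (l + 1)) hPq
    rw [coeff_mul, Finset.Nat.antidiagonal_succ, Finset.sum_cons, Finset.sum_map, hP0,
      Finset.Nat.sum_antidiagonal_eq_sum_range_succ_mk] at h
    simp [coeff_one] at h
    simp only [Matrix.mulVec, dotProduct, companionMatrix, Matrix.of_apply, if_true, shiftCoeff,
      Fin.val_zero, Nat.zero_le, Nat.sub_zero]
    rw [Fin.sum_univ_eq_sum_range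
      (fun j => -coeff (j + 1) P * if j ≤ l then coeff (l - j) q else 0),
      eq_neg_of_add_eq_zero_left h, ← Finset.sum_neg_distrib]
    have e1 : ∑ j ∈ Finset.range (N + 1),
        (-coeff (j + 1) P * if j ≤ l then coeff (l - j) q else 0)
        = ∑ j ∈ Finset.range (N + 1 + (l + 1)),
        (-coeff (j + 1) P * if j ≤ l then coeff (l - j) q else 0) := by
      refine Finset.sum_subset (Finset.range_mono (by omega)) fun j _ hj => ?_
      rw [Finset.mem_range] at hj
      rw [hP _ (by omega)]
      simp
    rw [e1]
    symm
    refine (Finset.sum_subset (s₁ := Finset.range (l + 1)) (Finset.range_mono (by omega))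
      fun j _ hj => ?_).symm.trans ?_ |>.symm
    · rw [Finset.mem_range] at hj
      rw [if_neg (by omega), mul_zero]
    · refine Finset.sum_congr rfl fun j hj => ?_
      rw [Finset.mem_range] at hj
      rw [if_pos (by omega), neg_mul]
  · simp only [Matrix.mulVec, dotProduct, companionMatrix, Matrix.of_apply, Fin.succ_ne_zero,
      if_false, Fin.val_succ, add_left_inj, ite_mul, one_mul, zero_mul]
    rw [Finset.sum_eq_single i.castSucc]
    · simp [shiftCoeff]
    · intro j _ hj
      rw [if_neg]
      intro h
      exact hj (Fin.ext h.symm)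
    · simp

theorem companionMatrix_pow_mulVec {P q : K⟦X⟧} (hPq : P * q = 1) (hP0 : coeff 0 P = 1)
    (hP : ∀ k, N + 1 < k → coeff k P = 0) (l m : ℕ) :
    (companionMatrix N P ^ m).mulVec (fun i : Fin (N + 1) => shiftCoeff q l i)
      = fun i : Fin (N + 1) => shiftCoeff q (l + m) i := by
  induction m with
  | zero => simp
  | succ m ih =>
    rw [pow_succ', ← Matrix.mulVec_mulVec, ih, companionMatrix_mulVec hPq hP0 hP]
    rfl

theorem det_matrixSubst_companionMatrix {P q : K⟦X⟧} (hPq : P * q = 1) (hP0 : coeff 0 P = 1)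
    (hP : ∀ k, N + 1 < k → coeff k P = 0) (f : K⟦X⟧) :
    (matrixSubst (companionMatrix N P) f).det
      = (Matrix.of fun i j : Fin (N + 1) =>
          PowerSeries.mk fun m => coeff m f * shiftCoeff q (j + m) i).det := by
  have hq : coeff 0 q = 1 := by
    have := congrArg (coeff 0) hPq
    rw [coeff_mul] at this
    simpa [hP0] using this
  set U : Matrix (Fin (N + 1)) (Fin (N + 1)) K⟦X⟧ :=
    Matrix.of fun i j => PowerSeries.C (shiftCoeff q j i) with hU
  have hdet : U.det = 1 := by
    rw [Matrix.det_of_isUpperTriangular]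
    · simp only [hU, Matrix.of_apply, shiftCoeff, le_refl, if_true, Nat.sub_self, hq]
      simp
    · intro i j hij
      have : ¬ (i : ℕ) ≤ j := not_le.2 hij
      simp only [hU, Matrix.of_apply, shiftCoeff, if_neg this, map_zero]
  rw [← mul_one (Matrix.det (matrixSubst _ _)), ← hdet, ← Matrix.det_mul]
  congr 1
  ext i j m
  have := congrFun (companionMatrix_pow_mulVec (N := N) hPq hP0 hP j m) i
  simp only [Matrix.mulVec, dotProduct] at this
  simp only [matrixSubst, hU, Matrix.mul_apply, Matrix.of_apply, map_sum, coeff_mul_C, coeff_mk]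
  rw [← this, Finset.mul_sum]
  exact Finset.sum_congr rfl fun k _ => by ring

theorem det_matrixSubst_one_sub_X {P : K⟦X⟧} (hP0 : coeff 0 P = 1)
    (hP : ∀ k, N + 1 < k → coeff k P = 0) :
    (matrixSubst (companionMatrix N P) (1 - X)).det = P := by
  have hent (i j : Fin (N + 1)) : matrixSubst (companionMatrix N P) (1 - X) i j
      = (if i = j then 1 else 0) - PowerSeries.C (companionMatrix N P i j) * X := by
    ext m
    simp only [matrixSubst, Matrix.of_apply, coeff_mk, map_sub, coeff_C_mul, coeff_X, coeff_one]
    rcases m with _ | _ | m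
    · by_cases h : i = j <;> simp [h]
    · by_cases h : i = j <;> simp [h, coeff_one]
    · by_cases h : i = j <;> simp [h, coeff_one]
  set E : Matrix (Fin (N + 1)) (Fin (N + 1)) K⟦X⟧ :=
    Matrix.of fun i j => if j ≤ i then X ^ (i - j : ℕ) else 0 with hE
  have hEdet : E.det = 1 := by
    rw [Matrix.det_of_isLowerTriangular]
    · simp [hE]
    · intro i j hij
      have : ¬ j ≤ i := not_le.2 hij
      simp [hE, this]
  have hsucc (i : Fin N) (j) : (matrixSubst (companionMatrix N P) (1 - X) * E) i.succ j
      = if i.succ = j then 1 else 0 := by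
    rw [Matrix.mul_apply]
    simp only [hent, sub_mul, Finset.sum_sub_distrib, ite_mul, one_mul, zero_mul,
      Finset.sum_ite_eq, Finset.mem_univ, if_true]
    rw [Finset.sum_eq_single i.castSucc]
    · simp only [companionMatrix, hE, Matrix.of_apply, Fin.succ_ne_zero, if_false, Fin.val_succ,
        Fin.val_castSucc, if_true, map_one, one_mul]
      rcases lt_trichotomy (j : ℕ) (i + 1) with h | h | h
      · have h1 : j ≤ i.succ := by rw [Fin.le_def, Fin.val_succ]; omega
        have h2 : j ≤ i.castSucc := by rw [Fin.le_def, Fin.val_castSucc]; omega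
        have h3 : i.succ ≠ j := by rw [Ne, Fin.ext_iff, Fin.val_succ]; omega
        rw [if_pos h1, if_pos h2, if_neg h3, ← pow_succ',
          show (i : ℕ) + 1 - j = i - j + 1 by omega, sub_self]
      · have h1 : j = i.succ := Fin.ext (by rw [Fin.val_succ]; omega)
        have h2 : ¬ j ≤ i.castSucc := by rw [Fin.le_def, Fin.val_castSucc]; omega
        rw [if_neg h2]
        simp [h1]
      · have h1 : ¬ j ≤ i.succ := by rw [Fin.le_def, Fin.val_succ]; omega
        have h2 : ¬ j ≤ i.castSucc := by rw [Fin.le_def, Fin.val_castSucc]; omega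
        have h3 : i.succ ≠ j := by rw [Ne, Fin.ext_iff, Fin.val_succ]; omega
        rw [if_neg h1, if_neg h2, if_neg h3]
        simp
    · intro k _ hk
      have : ¬ (i : ℕ) = k := fun h => hk (Fin.ext h.symm)
      simp [companionMatrix, this]
    · simp
  have hmul : (matrixSubst (companionMatrix N P) (1 - X)).det
      = (matrixSubst (companionMatrix N P) (1 - X) * E).det := by
    rw [Matrix.det_mul, hEdet, mul_one]
  rw [hmul, Matrix.det_of_isUpperTriangular]
  · rw [Fin.prod_univ_succ]
    simp only [hsucc, if_true, Finset.prod_const_one, mul_one]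
    rw [Matrix.mul_apply]
    simp only [hent, sub_mul, Finset.sum_sub_distrib, ite_mul, one_mul, zero_mul,
      Finset.sum_ite_eq, Finset.mem_univ, if_true]
    simp only [hE, companionMatrix, Matrix.of_apply, if_true, le_refl, Fin.zero_le, Fin.val_zero,
      Nat.sub_zero, pow_zero]
    rw [Fin.sum_univ_eq_sum_range (fun j => PowerSeries.C (-coeff (j + 1) P) * X * X ^ j)]
    ext m
    rcases m with _ | m
    · simp only [map_sub, map_sum, mul_assoc, ← pow_succ', coeff_C_mul, coeff_X_pow, hP0]
      simp
    · simp only [map_sub, map_sum, mul_assoc, ← pow_succ', coeff_C_mul, coeff_X_pow]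
      by_cases hm : m < N + 1
      · simp [coeff_one, hm]
      · rw [hP _ (by omega)]
        simp [coeff_one, hm]
  · intro i j hij
    obtain rfl | ⟨i, rfl⟩ := Fin.eq_zero_or_eq_succ i
    · exact absurd hij (by simp)
    · rw [hsucc, if_neg]
      rintro rfl
      exact lt_irrefl _ hij

end Companion

section FormalCauchy

open PowerSeries

variable {K : Type*} [Field K]

theorem StrictMono.fin_val_le {N L : ℕ} {s : Fin N → Fin L} (hs : StrictMono s) (k : Fin N) :
    (k : ℕ) ≤ s k := by
  obtain ⟨k, hk⟩ := k
  induction k with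
  | zero => exact Nat.zero_le _
  | succ k ih =>
    have h1 : s ⟨k, by omega⟩ < s ⟨k + 1, hk⟩ := hs (Fin.mk_lt_mk.2 k.lt_succ_self)
    exact (ih (by omega)).trans_lt h1

theorem coeff_eq_of_logDeriv_coeff_eq [CharZero K] {f g F G : K⟦X⟧} (hf : d⁄dX K f = F * f)
    (hg : d⁄dX K g = G * g) (h0 : coeff 0 f = coeff 0 g) {M : ℕ}
    (hFG : ∀ m < M, coeff m F = coeff m G) :
    ∀ m ≤ M, coeff m f = coeff m g := by
  intro m
  induction m using Nat.strong_induction_on with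
  | _ m ih =>
    intro hm
    rcases m with _ | m
    · exact h0
    · have h1 := congrArg (coeff m) hf
      have h2 := congrArg (coeff m) hg
      rw [coeff_derivative, coeff_mul] at h1 h2
      have hne : (m + 1 : K) ≠ 0 := by exact_mod_cast m.succ_ne_zero
      refine mul_right_cancel₀ hne ?_
      rw [h1, h2]
      refine Finset.sum_congr rfl fun p hp => ?_
      rw [Finset.HasAntidiagonal.mem_antidiagonal] at hp
      rw [hFG _ (by omega), ih _ (by omega) (by omega)]

/-- The inverse of the truncation of `g⁻¹` to degree at most `N + 1`. -/
def truncInv (N : ℕ) (g : K⟦X⟧) : K⟦X⟧ :=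
  PowerSeries.mk fun k => if k ≤ N + 1 then coeff k g⁻¹ else 0

theorem coeff_truncInv_inv (N : ℕ) {g : K⟦X⟧} (hg : constantCoeff g = 1) :
    ∀ k ≤ N + 1, coeff k (truncInv N g)⁻¹ = coeff k g := by
  have hP : constantCoeff (truncInv N g) = 1 := by
    rw [← coeff_zero_eq_constantCoeff_apply]
    simp [truncInv, hg]
  have h1 : X ^ (N + 2) ∣ g⁻¹ - truncInv N g := by
    rw [X_pow_dvd_iff]
    intro m hm
    simp [truncInv, show m ≤ N + 1 by omega]
  have h2 : (truncInv N g)⁻¹ - g = (truncInv N g)⁻¹ * g * (g⁻¹ - truncInv N g) := by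
    have e1 : g * g⁻¹ = 1 := PowerSeries.mul_inv_cancel _ (by simp [hg])
    have e2 : truncInv N g * (truncInv N g)⁻¹ = 1 := PowerSeries.mul_inv_cancel _ (by simp [hP])
    linear_combination (-(truncInv N g)⁻¹) * e1 + g * e2
  intro k hk
  have h3 : X ^ (N + 2) ∣ (truncInv N g)⁻¹ - g := h2 ▸ Dvd.dvd.mul_left h1 _
  rw [X_pow_dvd_iff] at h3
  have := h3 k (by omega)
  rwa [map_sub, sub_eq_zero] at this

/-- The determinant with generating function `e` whose logarithmic derivative is the coefficientwise
product of those of `f` and `g`. -/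
theorem coeff_eq_coeff_det [CharZero K] {f g e F G : K⟦X⟧} (hf : d⁄dX K f = F * f)
    (hg : d⁄dX K g = G * g)
    (he : d⁄dX K e = (PowerSeries.mk fun m => coeff m F * coeff m G) * e)
    (hf0 : constantCoeff f = 1) (hg0 : constantCoeff g = 1) (he0 : constantCoeff e = 1)
    (N n : ℕ) (hn : n ≤ N + 1) :
    coeff n e = coeff n (Matrix.of fun i j : Fin (N + 1) =>
      PowerSeries.mk fun m => coeff m f * shiftCoeff (truncInv N g)⁻¹ (j + m) i).det := by
  set P := truncInv N g with hPdef
  have hP0 : coeff 0 P = 1 := by simp [hPdef, truncInv, hg0]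
  have hP : ∀ k, N + 1 < k → coeff k P = 0 := fun k hk => by
    simp [hPdef, truncInv, not_le.2 hk]
  have hPq : P * P⁻¹ = 1 := PowerSeries.mul_inv_cancel _ (by
    rw [← coeff_zero_eq_constantCoeff_apply, hP0]; exact one_ne_zero)
  rw [← det_matrixSubst_companionMatrix hPq hP0 hP f]
  have hq := coeff_truncInv_inv N hg0
  rw [← hPdef] at hq
  set S : K⟦X⟧ := PowerSeries.mk fun m => ((companionMatrix N P) ^ (m + 1)).trace with hS
  have hPder : d⁄dX K P = -S * P := by
    have h1 := derivative_det_matrixSubst (companionMatrix N P) (1 - X)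
      (-(PowerSeries.mk fun _ => 1)) (by
        have : (PowerSeries.mk fun _ => (1 : K)) * (1 - X) = 1 := mk_one_mul_one_sub_eq_one K
        simp [this])
    rw [det_matrixSubst_one_sub_X hP0 hP] at h1
    rw [h1]
    congr 1
    ext m
    simp [hS]
  have hqder : d⁄dX K P⁻¹ = S * P⁻¹ := by
    rw [derivative_inv', hPder]
    linear_combination (S * P⁻¹) * hPq
  have hSG : ∀ m < N + 1, coeff m S = coeff m G := by
    have h1 : X ^ (N + 1) ∣ (S - G) * P⁻¹ := by
      have : (S - G) * P⁻¹ = d⁄dX K (P⁻¹ - g) - G * (P⁻¹ - g) := by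
        rw [map_sub, hqder, hg]; ring
      rw [this, X_pow_dvd_iff]
      intro m hm
      rw [map_sub, coeff_derivative, map_sub, hq _ (by omega), sub_self, zero_mul, zero_sub,
        neg_eq_zero, coeff_mul]
      refine Finset.sum_eq_zero fun p hp => ?_
      rw [Finset.HasAntidiagonal.mem_antidiagonal] at hp
      rw [map_sub, hq _ (by omega), sub_self, mul_zero]
    have h2 : X ^ (N + 1) ∣ S - G := by
      have : S - G = (S - G) * P⁻¹ * P := by linear_combination (-(S - G)) * hPq
      rw [this]
      exact Dvd.dvd.mul_right h1 _
    intro m hm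
    have := (X_pow_dvd_iff.1 h2) m hm
    rwa [map_sub, sub_eq_zero] at this
  refine coeff_eq_of_logDeriv_coeff_eq he (derivative_det_matrixSubst _ f F hf) ?_
    (M := N + 1) ?_ n hn
  · rw [det_matrixSubst_companionMatrix hPq hP0 hP f]
    have h0 : (matrixSubst (companionMatrix N P) f).map constantCoeff = 1 := by
      ext i j
      rw [Matrix.map_apply, ← coeff_zero_eq_constantCoeff_apply]
      simp [matrixSubst, hf0]
    rw [← det_matrixSubst_companionMatrix hPq hP0 hP f, coeff_zero_eq_constantCoeff_apply,
      coeff_zero_eq_constantCoeff_apply, RingHom.map_det, he0]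
    exact (congrArg Matrix.det h0).trans Matrix.det_one |>.symm
  · intro m hm
    rw [coeff_mk, coeff_mk, ← hSG m hm, hS, coeff_mk]

theorem coeff_det_eq_of_coeff_eq {n : Type*} [Fintype n] [DecidableEq n] {A B : Matrix n n K⟦X⟧}
    {m : ℕ} (h : ∀ i j, ∀ k ≤ m, coeff k (A i j) = coeff k (B i j)) :
    coeff m A.det = coeff m B.det := by
  have h1 : (Ideal.Quotient.mk (Ideal.span {(X : K⟦X⟧) ^ (m + 1)})) A.det
      = (Ideal.Quotient.mk (Ideal.span {(X : K⟦X⟧) ^ (m + 1)})) B.det := by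
    rw [RingHom.map_det, RingHom.map_det]
    congr 1
    ext i j
    rw [RingHom.mapMatrix_apply, RingHom.mapMatrix_apply, Matrix.map_apply, Matrix.map_apply,
      Ideal.Quotient.eq, Ideal.mem_span_singleton, X_pow_dvd_iff]
    intro k hk
    rw [map_sub, h i j k (by omega), sub_self]
  rw [Ideal.Quotient.eq, Ideal.mem_span_singleton, X_pow_dvd_iff] at h1
  have := h1 m (by omega)
  rwa [map_sub, sub_eq_zero] at this

theorem det_shiftCoeff_mul_X_pow (f : K⟦X⟧) {N : ℕ} {s : Fin N → ℕ} (hs : ∀ i : Fin N, (i : ℕ) ≤ s i) :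
    (Matrix.of fun j k : Fin N => PowerSeries.C (shiftCoeff f (s k) j) * X ^ (s k - j)).det
      = PowerSeries.C (Matrix.of fun j k : Fin N => shiftCoeff f (s k) j).det
        * X ^ (∑ k, (s k - k)) := by
  have hX : (X : K⟦X⟧) ^ (∑ k : Fin N, (k : ℕ)) ≠ 0 := pow_ne_zero _ X_ne_zero
  refine mul_left_cancel₀ hX ?_
  have e1 : (X : K⟦X⟧) ^ (∑ k : Fin N, (k : ℕ)) = ∏ k : Fin N, X ^ (k : ℕ) :=
    (Finset.prod_pow_eq_pow_sum _ _ _).symm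
  have e2 : (X : K⟦X⟧) ^ (∑ k : Fin N, (k : ℕ)) * X ^ (∑ k, (s k - k))
      = ∏ k : Fin N, X ^ (s k) := by
    rw [← pow_add, ← Finset.sum_add_distrib, Finset.prod_pow_eq_pow_sum]
    congr 1
    exact Finset.sum_congr rfl fun k _ => Nat.add_sub_cancel' (hs k)
  rw [mul_left_comm, e2, e1, ← Matrix.det_mul_column, RingHom.map_det, mul_comm,
    ← Matrix.det_mul_row]
  congr 1
  ext1 j k
  simp only [Matrix.of_apply, RingHom.mapMatrix_apply, Matrix.map_apply]
  by_cases h : (j : ℕ) ≤ s k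
  · rw [mul_left_comm, ← pow_add, Nat.add_sub_cancel' h, mul_comm]
  · simp [shiftCoeff, h]

theorem coeff_det_eq_sum_orderEmb (f q : K⟦X⟧) (N n : ℕ) :
    coeff n (Matrix.of fun i j : Fin (N + 1) =>
      PowerSeries.mk fun m => coeff m f * shiftCoeff q (j + m) i).det
    = ∑ s : Fin (N + 1) ↪o Fin (N + 1 + n), if n = ∑ k, ((s k : ℕ) - k) then
        (Matrix.of fun j k : Fin (N + 1) => shiftCoeff q (s k) j).det *
        (Matrix.of fun j k : Fin (N + 1) => shiftCoeff f (s k) j).det else 0 := by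
  set B : Matrix (Fin (N + 1)) (Fin (N + 1 + n)) K⟦X⟧ :=
    Matrix.of fun i l => PowerSeries.C (shiftCoeff q l i) with hB
  set A : Matrix (Fin (N + 1)) (Fin (N + 1 + n)) K⟦X⟧ :=
    Matrix.of fun j l => PowerSeries.C (shiftCoeff f l j) * X ^ (l - j : ℕ) with hA
  rw [coeff_det_eq_of_coeff_eq (B := B * A.transpose), Matrix.det_mul_transpose_eq_sum_orderEmb,
    map_sum]
  · refine Finset.sum_congr rfl fun s _ => ?_
    have hs : ∀ k : Fin (N + 1), (k : ℕ) ≤ s k := fun k =>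
      s.strictMono.fin_val_le k
    have e1 : (B.submatrix id s).det
        = PowerSeries.C (Matrix.of fun j k : Fin (N + 1) => shiftCoeff q (s k) j).det := by
      rw [RingHom.map_det]
      rfl
    have e2 : (A.submatrix id s).det = _ := det_shiftCoeff_mul_X_pow f hs
    rw [e1, e2, coeff_C_mul, coeff_C_mul, coeff_X_pow]
    split_ifs <;> simp
  · intro i j k hk
    simp only [Matrix.of_apply, coeff_mk, Matrix.mul_apply, Matrix.transpose_apply, map_sum, hA,
      hB, coeff_C_mul, coeff_X_pow]
    rw [Finset.sum_eq_single (⟨j + k, by omega⟩ : Fin (N + 1 + n))]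
    · simp only [shiftCoeff, Nat.le_add_right, if_true, Nat.add_sub_cancel_left, mul_one]
      ring
    · intro l _ hl
      have : ¬ ((j : ℕ) ≤ l ∧ k = l - j) := fun h => hl (Fin.ext (by simp; omega))
      by_cases h1 : (j : ℕ) ≤ l
      · rw [if_neg fun h => this ⟨h1, h⟩]
        simp
      · simp [shiftCoeff, h1]
    · simp

end FormalCauchy

section Partitions

namespace Partition'

theorem part_eq_zero_iff_s3 (lam : Partition') {i : ℕ} : lam.part i = 0 ↔ lam.len ≤ i := by
  obtain ⟨N, hN⟩ := lam.ev_zero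
  have hlen : lam.part lam.len = 0 :=
    Nat.sInf_mem (s := {N | lam.part N = 0}) ⟨N, hN N le_rfl⟩
  refine ⟨fun h => Nat.sInf_le h, fun h => ?_⟩
  have := lam.antitone h
  omega

/-- The number of boxes of a Young diagram. -/
def size (lam : Partition') : ℕ := ∑ i ∈ Finset.range lam.len, lam.part i

theorem sum_range_part (lam : Partition') {M : ℕ} (hM : lam.len ≤ M) :
    ∑ i ∈ Finset.range M, lam.part i = lam.size := by
  refine (Finset.sum_subset (Finset.range_mono hM) fun i _ hi => ?_).symm
  rw [Finset.mem_range, not_lt] at hi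
  exact lam.part_eq_zero_iff_s3.2 hi

theorem part_add_len_le (lam : Partition') {i : ℕ} (hi : i < lam.len) :
    lam.part i + lam.len ≤ lam.size + 1 := by
  have h1 : ∑ j ∈ Finset.range lam.len, 1 ≤ ∑ j ∈ Finset.range lam.len, lam.part j - lam.part i + 1 := by
    rw [← Finset.add_sum_erase _ _ (Finset.mem_range.2 hi),
      ← Finset.add_sum_erase _ lam.part (Finset.mem_range.2 hi), Nat.add_sub_cancel_left, add_comm]
    refine Nat.add_le_add_right (Finset.sum_le_sum fun j hj => ?_) 1
    have hj' : j < lam.len := Finset.mem_range.1 (Finset.mem_of_mem_erase hj)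
    have := (lam.part_eq_zero_iff_s3 (i := j)).not.2 (not_le.2 hj')
    omega
  have h2 : lam.part i ≤ lam.size :=
    Finset.single_le_sum (fun _ _ => Nat.zero_le _) (Finset.mem_range.2 hi)
  simp only [Finset.sum_const, Finset.card_range, smul_eq_mul, mul_one] at h1
  change lam.len ≤ lam.size - lam.part i + 1 at h1
  omega

theorem len_le_size (lam : Partition') : lam.len ≤ lam.size := by
  by_cases h : lam.len = 0
  · omega
  · have h0 : 0 < lam.len := by omega
    have h1 := lam.part_add_len_le h0
    have := (lam.part_eq_zero_iff_s3 (i := 0)).not.2 (not_le.2 h0)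
    omega

theorem part_le_size (lam : Partition') (i : ℕ) : lam.part i ≤ lam.size := by
  by_cases h : i < lam.len
  · have := lam.part_add_len_le h
    omega
  · have := lam.part_eq_zero_iff_s3.2 (not_lt.1 h)
    omega

/-- The Jacobi–Trudi determinant does not depend on its size, once the latter is at least the
number of parts. -/
theorem det_jacobiTrudi_eq {K : Type*} [CommRing K] {a : ℤ → K} (h0 : a 0 = 1)
    (hneg : ∀ k < 0, a k = 0) (lam : Partition') {M : ℕ} (hM : lam.len ≤ M) :
    (Matrix.of fun i j : Fin M => a ((lam.part i : ℤ) + (j : ℤ) - (i : ℤ))).det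
      = (Matrix.of fun i j : Fin lam.len => a ((lam.part i : ℤ) + (j : ℤ) - (i : ℤ))).det := by
  induction M, hM using Nat.le_induction with
  | base => rfl
  | succ M hM ih =>
    rw [← ih, Matrix.det_succ_row _ (Fin.last M), Finset.sum_eq_single (Fin.last M)]
    · have hz := lam.part_eq_zero_iff_s3.2 hM
      simp only [Matrix.of_apply, Fin.val_last, hz]
      rw [Even.neg_one_pow ⟨M, rfl⟩]
      simp only [Nat.cast_zero, zero_add, sub_self, h0, one_mul]
      congr 1
      ext i j
      simp
    · intro j _ hj
      have hz := lam.part_eq_zero_iff_s3.2 hM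
      have hlt : (j : ℕ) < M := Fin.val_lt_last hj
      simp only [Matrix.of_apply, Fin.val_last, hz]
      rw [hneg _ (by push_cast; omega)]
      simp
    · simp

/-- The strictly increasing sequence `k ↦ λ_{N+1-k} + k` for `0 ≤ k ≤ N`. -/
def shiftedParts (N n : ℕ) (lam : {lam : Partition' // lam.size = n}) :
    Fin (N + 1) ↪o Fin (N + 1 + n) :=
  OrderEmbedding.ofStrictMono
    (fun k => ⟨lam.1.part (N - k) + k, by
      have h1 := lam.1.part_le_size (N - k)
      have h2 := lam.2
      omega⟩)
    (fun k l hkl => by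
      have h1 : N - (l : ℕ) ≤ N - k := by
        have : (k : ℕ) < l := hkl
        omega
      have h2 := lam.1.antitone h1
      have h3 : (k : ℕ) < l := hkl
      rw [Fin.lt_def]
      simp only
      omega)

theorem shiftedParts_apply (N n : ℕ) (lam : {lam : Partition' // lam.size = n})
    (k : Fin (N + 1)) : (shiftedParts N n lam k : ℕ) = lam.1.part (N - k) + k := rfl

theorem sum_shiftedParts (N n : ℕ) (hn : n ≤ N + 1) (lam : {lam : Partition' // lam.size = n}) :
    ∑ k, ((shiftedParts N n lam k : ℕ) - k) = n := by
  simp only [shiftedParts_apply, Nat.add_sub_cancel]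
  change ∑ k : Fin (N + 1), lam.1.part (N + 1 - 1 - k) = n
  rw [Fin.sum_univ_eq_sum_range (fun k => lam.1.part (N + 1 - 1 - k)),
    Finset.sum_range_reflect, lam.1.sum_range_part, lam.2]
  have := lam.1.len_le_size
  have := lam.2
  omega

theorem shiftedParts_injective (N n : ℕ) (hn : n ≤ N + 1) :
    Function.Injective (shiftedParts N n) := by
  intro lam mu h
  have hpart : lam.1.part = mu.1.part := by
    funext i
    by_cases hi : i ≤ N
    · have h1 : (shiftedParts N n lam ⟨N - i, by omega⟩ : ℕ)
          = shiftedParts N n mu ⟨N - i, by omega⟩ := by rw [h]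
      rw [shiftedParts_apply, shiftedParts_apply] at h1
      simp only [Nat.sub_sub_self hi] at h1
      omega
    · have h1 := lam.1.len_le_size
      have h2 := mu.1.len_le_size
      have h3 := lam.2
      have h4 := mu.2
      rw [lam.1.part_eq_zero_iff_s3.2 (by omega), mu.1.part_eq_zero_iff_s3.2 (by omega)]
  obtain ⟨⟨p, _, _⟩, _⟩ := lam
  obtain ⟨⟨q, _, _⟩, _⟩ := mu
  simp only at hpart
  subst hpart
  rfl

theorem exists_shiftedParts_eq {N n : ℕ} (s : Fin (N + 1) ↪o Fin (N + 1 + n))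
    (hs : ∑ k, ((s k : ℕ) - k) = n) : ∃ lam, shiftedParts N n lam = s := by
  have hmono : ∀ k l : Fin (N + 1), k ≤ l → (s k : ℕ) - k ≤ s l - l := by
    suffices h : ∀ d : ℕ, ∀ k l : Fin (N + 1), (l : ℕ) = k + d → (s k : ℕ) - k ≤ s l - l by
      intro k l hkl
      exact h (l - k) k l (by have : (k : ℕ) ≤ l := hkl; omega)
    intro d
    induction d with
    | zero =>
      intro k l h
      rw [show l = k from Fin.ext h]
    | succ d ih =>
      intro k l h
      have h1 := ih k ⟨k + d, by omega⟩ rfl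
      have h2 : (s ⟨k + d, by omega⟩ : ℕ) < s l :=
        s.strictMono (by rw [Fin.lt_def]; simp only; omega)
      simp only at h1
      omega
  set p : ℕ → ℕ := fun i => if h : i ≤ N then
    (s ⟨N - i, by omega⟩ : ℕ) - (N - i) else 0 with hp
  have hpN : ∀ i ≥ N + 1, p i = 0 := fun i hi => by
    simp only [hp]
    rw [dif_neg (by omega)]
  let lam : Partition' :=
    { part := p
      antitone := by
        intro i j hij
        by_cases hj : j ≤ N
        · have hi : i ≤ N := hij.trans hj
          simp only [hp, dif_pos hi, dif_pos hj]
          exact hmono ⟨N - j, by omega⟩ ⟨N - i, by omega⟩ (by rw [Fin.le_def]; simp only; omega)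
        · rw [hpN j (by omega)]
          exact Nat.zero_le _
      ev_zero := ⟨N + 1, hpN⟩ }
  have hps : ∀ k : Fin (N + 1), p (N - k) = s k - k := by
    intro k
    have hk : N - (N - (k : ℕ)) = k := by omega
    simp only [hp, dif_pos (Nat.sub_le N k), hk]
  have hlen : lam.len ≤ N + 1 := lam.part_eq_zero_iff_s3.1 (hpN _ le_rfl)
  have hsize : lam.size = n := by
    rw [← lam.sum_range_part hlen, ← Finset.sum_range_reflect,
      ← Fin.sum_univ_eq_sum_range (fun j => lam.part (N + 1 - 1 - j)), ← hs]
    exact Finset.sum_congr rfl fun k _ => hps k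
  refine ⟨⟨lam, hsize⟩, ?_⟩
  ext k
  rw [shiftedParts_apply]
  change p (N - k) + k = s k
  rw [hps, Nat.sub_add_cancel (s.strictMono.fin_val_le k)]

end Partition'

open PowerSeries in
/-- The Schur function attached to a generating series `f` of complete homogeneous functions. -/
def jacobiTrudi {K : Type*} [CommRing K] (f : K⟦X⟧) (lam : Partition') : K :=
  (Matrix.of fun i j : Fin lam.len =>
    if (lam.part i : ℤ) + j - i < 0 then 0
    else coeff ((lam.part i : ℤ) + j - i).toNat f).det

open PowerSeries in
theorem jacobiTrudi_congr {K : Type*} [CommRing K] {f g : K⟦X⟧} {lam : Partition'}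
    (h : ∀ k ≤ lam.size, coeff k f = coeff k g) : jacobiTrudi f lam = jacobiTrudi g lam := by
  unfold jacobiTrudi
  congr 1
  ext i j
  simp only [Matrix.of_apply]
  split_ifs with h1
  · rfl
  · refine h _ ?_
    have := lam.part_add_len_le i.2
    omega

open PowerSeries in
theorem det_shiftCoeff_shiftedParts {K : Type*} [CommRing K] {f : K⟦X⟧}
    (hf : constantCoeff f = 1) {N n : ℕ} (hn : n ≤ N + 1)
    (lam : {lam : Partition' // lam.size = n}) :
    (Matrix.of fun j k : Fin (N + 1) =>
      shiftCoeff f (Partition'.shiftedParts N n lam k) j).det = jacobiTrudi f lam.1 := by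
  have hlen : lam.1.len ≤ N + 1 := by
    have := lam.1.len_le_size
    have := lam.2
    omega
  unfold jacobiTrudi
  rw [← Partition'.det_jacobiTrudi_eq (a := fun k : ℤ => if k < 0 then 0 else coeff k.toNat f)
    (by simp [hf]) (fun k hk => if_pos hk) lam.1 hlen,
    ← Matrix.det_submatrix_equiv_self Fin.revPerm, ← Matrix.det_transpose]
  congr 1
  ext k j
  have hk : (Partition'.shiftedParts N n lam k.rev : ℕ) = lam.1.part k + (N - k) := by
    rw [Partition'.shiftedParts_apply, Fin.val_rev, Nat.add_sub_add_right,
      Nat.sub_sub_self (Nat.le_of_lt_succ k.2)]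
  have hj : (j.rev : ℕ) = N - j := by rw [Fin.val_rev, Nat.add_sub_add_right]
  simp only [Matrix.transpose_apply, Matrix.of_apply, Matrix.submatrix_apply, Fin.revPerm_apply,
    shiftCoeff, hk, hj]
  split_ifs with h1 h2 h2
  · omega
  · congr 2
    omega
  · rfl
  · omega

open PowerSeries in
/-- The Cauchy identity in degree `n`. -/
theorem hasSum_jacobiTrudi_mul {K : Type*} [Field K] [CharZero K] [TopologicalSpace K]
    {f g e F G : K⟦X⟧} (hf : d⁄dX K f = F * f) (hg : d⁄dX K g = G * g)
    (he : d⁄dX K e = (PowerSeries.mk fun m => coeff m F * coeff m G) * e)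
    (hf0 : constantCoeff f = 1) (hg0 : constantCoeff g = 1) (he0 : constantCoeff e = 1) (n : ℕ) :
    HasSum (fun lam : {lam : Partition' // lam.size = n} =>
      jacobiTrudi g lam.1 * jacobiTrudi f lam.1) (coeff n e) := by
  have hn : n ≤ n + 1 := n.le_succ
  rw [coeff_eq_coeff_det hf hg he hf0 hg0 he0 n n hn, coeff_det_eq_sum_orderEmb]
  set q := (truncInv n g)⁻¹ with hq
  have hqg := coeff_truncInv_inv n hg0
  rw [← hq] at hqg
  have hq0 : constantCoeff q = 1 := by
    rw [← coeff_zero_eq_constantCoeff_apply, hqg 0 (by omega),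
      coeff_zero_eq_constantCoeff_apply, hg0]
  have key : (fun lam : {lam : Partition' // lam.size = n} =>
      jacobiTrudi g lam.1 * jacobiTrudi f lam.1)
      = (fun s : Fin (n + 1) ↪o Fin (n + 1 + n) => if n = ∑ k, ((s k : ℕ) - k) then
          (Matrix.of fun j k : Fin (n + 1) => shiftCoeff q (s k) j).det *
          (Matrix.of fun j k : Fin (n + 1) => shiftCoeff f (s k) j).det else 0)
        ∘ Partition'.shiftedParts n n := by
    funext lam
    rw [Function.comp_apply, if_pos (Partition'.sum_shiftedParts n n hn lam).symm,
      det_shiftCoeff_shiftedParts hq0 hn, det_shiftCoeff_shiftedParts hf0 hn]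
    congr 1
    exact jacobiTrudi_congr fun k hk => (hqg k (by have := lam.2; omega)).symm
  rw [key, (Partition'.shiftedParts_injective n n hn).hasSum_iff]
  · exact hasSum_fintype _
  · intro s hs
    exact if_neg fun h => hs (Partition'.exists_shiftedParts_eq s h.symm)

end Partitions

section Analytic

open PowerSeries
open scoped Nat

/-- The Taylor series at the origin of a function of one complex variable. -/
def taylorPowerSeries (g : ℂ → ℂ) : ℂ⟦X⟧ :=
  PowerSeries.mk fun n => (n ! : ℂ)⁻¹ * iteratedDeriv n g 0

theorem taylorPowerSeries_mul {f g : ℂ → ℂ} (hf : AnalyticAt ℂ f 0) (hg : AnalyticAt ℂ g 0) :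
    taylorPowerSeries (f * g) = taylorPowerSeries f * taylorPowerSeries g := by
  ext m
  simp only [taylorPowerSeries, coeff_mk, iteratedDeriv_mul hf.contDiffAt hg.contDiffAt,
    Finset.mul_sum, PowerSeries.coeff_mul, Finset.Nat.sum_antidiagonal_eq_sum_range_succ_mk,
    Nat.succ_eq_add_one]
  refine Finset.sum_congr rfl fun i hi ↦ ?_
  rw [Nat.cast_choose _ (by grind)]
  field_simp [Nat.factorial_ne_zero]

theorem taylorPowerSeries_deriv (g : ℂ → ℂ) :
    taylorPowerSeries (deriv g) = d⁄dX ℂ (taylorPowerSeries g) := by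
  ext m
  have h1 : ((m : ℂ) + 1) ≠ 0 := by exact_mod_cast m.succ_ne_zero
  have h2 : (m ! : ℂ) ≠ 0 := by exact_mod_cast m.factorial_ne_zero
  simp only [taylorPowerSeries, coeff_mk, coeff_derivative, iteratedDeriv_succ',
    Nat.factorial_succ]
  push_cast
  field_simp

theorem taylorPowerSeries_congr {f g : ℂ → ℂ} (h : f =ᶠ[nhds 0] g) :
    taylorPowerSeries f = taylorPowerSeries g := by
  ext m
  simp only [taylorPowerSeries, coeff_mk, h.iteratedDeriv_eq m]

theorem derivative_taylorPowerSeries_cexp {F : ℂ → ℂ} (hF : AnalyticAt ℂ F 0) :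
    d⁄dX ℂ (taylorPowerSeries fun z => Complex.exp (F z)) =
      d⁄dX ℂ (taylorPowerSeries F) * taylorPowerSeries fun z => Complex.exp (F z) := by
  rw [← taylorPowerSeries_deriv, ← taylorPowerSeries_deriv F,
    ← taylorPowerSeries_mul (g := fun z => Complex.exp (F z)) hF.deriv hF.cexp]
  refine taylorPowerSeries_congr ?_
  filter_upwards [hF.eventually_analyticAt] with z hz
  rw [(hz.differentiableAt.hasDerivAt.cexp).deriv, Pi.mul_apply, mul_comm]

/-- The power series `∑_{n ≥ 1} t_n X^n`. -/
def expSeries (t : ℕ → ℂ) : ℂ⟦X⟧ := PowerSeries.mk fun n => n.casesOn 0 t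

theorem RSummable.hasFPowerSeriesOnBall {R : ℝ} (hR : 0 < R) {t : ℕ → ℂ} (ht : RSummable R t) :
    HasFPowerSeriesOnBall (fun z => ∑' n : ℕ, t n * z ^ (n + 1))
      (FormalMultilinearSeries.ofScalars ℂ fun n => coeff n (expSeries t)) 0
      (ENNReal.ofReal R) where
  r_le := by
    refine FormalMultilinearSeries.le_radius_of_summable _ ?_
    rw [Real.coe_toNNReal R hR.le, ← summable_nat_add_iff 1]
    simpa [expSeries, FormalMultilinearSeries.ofScalars_norm, RSummable] using ht
  r_pos := by simpa using hR
  hasSum := by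
    intro y hy
    have hy' : ‖y‖ < R := by simpa using hy
    have hs : Summable fun n : ℕ => t n * y ^ (n + 1) := by
      refine Summable.of_norm_bounded ht fun n => ?_
      rw [norm_mul, norm_pow]
      gcongr
    rw [zero_add, ← hasSum_nat_add_iff' 1]
    simpa [expSeries, FormalMultilinearSeries.ofScalars_apply_eq, mul_comm] using hs.hasSum

theorem RSummable.taylorPowerSeries_eq {R : ℝ} (hR : 0 < R) {t : ℕ → ℂ} (ht : RSummable R t) :
    taylorPowerSeries (fun z => ∑' n : ℕ, t n * z ^ (n + 1)) = expSeries t := by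
  ext n
  have h := (ht.hasFPowerSeriesOnBall hR).factorial_smul 1 n
  rw [iteratedFDeriv_apply_eq_iteratedDeriv_mul_prod, Finset.prod_const_one, one_smul] at h
  have h2 : (n ! : ℂ) ≠ 0 := by exact_mod_cast n.factorial_ne_zero
  simp only [taylorPowerSeries, coeff_mk]
  rw [← h]
  simp [h2]

theorem RSummable.differentiableOn_gammaFn {R : ℝ} (hR : 0 < R) {t : ℕ → ℂ}
    (ht : RSummable R t) : DifferentiableOn ℂ (fun z => gammaFn z t) (Metric.ball 0 R) := by
  have h := (ht.hasFPowerSeriesOnBall hR).differentiableOn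
  rw [Metric.eball_ofReal] at h
  exact h.cexp

/-- The generating series of the `h_k(t)`. -/
def hcoefSeries (t : ℕ → ℂ) : ℂ⟦X⟧ := PowerSeries.mk fun k => hcoef t k

theorem RSummable.hcoefSeries_eq {R : ℝ} (hR : 1 < R) {t : ℕ → ℂ} (ht : RSummable R t) :
    hcoefSeries t = taylorPowerSeries fun z => gammaFn z t := by
  ext n
  have hd : DiffContOnCl ℂ (fun z => gammaFn z t) (Metric.ball 0 1) := by
    refine DifferentiableOn.diffContOnCl ?_
    rw [closure_ball _ one_ne_zero]
    exact (ht.differentiableOn_gammaFn (by linarith)).mono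
      (Metric.closedBall_subset_ball hR)
  have h := hd.circleIntegral_one_div_sub_center_pow_smul one_pos n
  have h2 : (n ! : ℂ) ≠ 0 := by exact_mod_cast n.factorial_ne_zero
  have hpi : (Real.pi : ℂ) ≠ 0 := by exact_mod_cast Real.pi_ne_zero
  simp only [hcoefSeries, taylorPowerSeries, coeff_mk, hcoef]
  rw [if_neg (by simp)]
  have h3 : (∮ z in C(0, 1), (1 / (z - 0) ^ (n + 1)) • gammaFn z t) =
      Complex.I * ∫ θ in (0:ℝ)..(2 * Real.pi),
        gammaFn (Complex.exp (θ * Complex.I)) t *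
          Complex.exp (-((n : ℤ) : ℂ) * θ * Complex.I) := by
    rw [circleIntegral, ← intervalIntegral.integral_const_mul]
    refine intervalIntegral.integral_congr fun θ _ => ?_
    have h4 : Complex.exp (-((n : ℤ) : ℂ) * θ * Complex.I) =
        (Complex.exp (θ * Complex.I) ^ n)⁻¹ := by
      rw [← Complex.exp_nat_mul, ← Complex.exp_neg]
      push_cast
      ring_nf
    have h5 := Complex.exp_ne_zero (θ * Complex.I)
    simp only [deriv_circleMap, circleMap, h4, smul_eq_mul]
    simp only [Complex.ofReal_one, zero_add, one_mul, sub_zero]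
    field_simp
    ring
  rw [h3, smul_eq_mul] at h
  have h6 : (∫ θ in (0:ℝ)..(2 * Real.pi), gammaFn (Complex.exp (θ * Complex.I)) t *
      Complex.exp (-((n : ℤ) : ℂ) * θ * Complex.I)) =
        2 * Real.pi / n ! * iteratedDeriv n (fun z => gammaFn z t) 0 := by
    apply mul_left_cancel₀ Complex.I_ne_zero
    rw [h]
    ring
  rw [h6]
  field_simp

theorem RSummable.derivative_hcoefSeries {R : ℝ} (hR : 1 < R) {t : ℕ → ℂ}
    (ht : RSummable R t) :
    d⁄dX ℂ (hcoefSeries t) = d⁄dX ℂ (expSeries t) * hcoefSeries t := by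
  have h0 : 0 < R := by linarith
  rw [ht.hcoefSeries_eq hR, ← ht.taylorPowerSeries_eq h0]
  exact derivative_taylorPowerSeries_cexp (ht.hasFPowerSeriesOnBall h0).analyticAt

theorem RSummable.constantCoeff_hcoefSeries {R : ℝ} (hR : 1 < R) {t : ℕ → ℂ}
    (ht : RSummable R t) : constantCoeff (hcoefSeries t) = 1 := by
  rw [ht.hcoefSeries_eq hR, ← coeff_zero_eq_constantCoeff_apply]
  simp [taylorPowerSeries, gammaFn]

theorem RSummable.hasSum_coeff_hcoefSeries {R : ℝ} (hR : 1 < R) {t : ℕ → ℂ}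
    (ht : RSummable R t) :
    HasSum (fun n => coeff n (hcoefSeries t)) (Complex.exp (∑' n : ℕ, t n)) := by
  have h := Complex.hasSum_taylorSeries_on_ball (z := 1)
    (ht.differentiableOn_gammaFn (by linarith)) (by simpa using hR)
  rw [ht.hcoefSeries_eq hR]
  simpa [taylorPowerSeries, gammaFn] using h

theorem schurPoly_eq_jacobiTrudi (t : ℕ → ℂ) (lam : Partition') :
    schurPoly t lam = jacobiTrudi (hcoefSeries t) lam := by
  unfold schurPoly jacobiTrudi
  congr 2
  ext i j
  split_ifs with h
  · simp [hcoef, h]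
  · simp only [hcoefSeries, coeff_mk]
    rw [Int.toNat_of_nonneg (not_lt.mp h)]

theorem RingHom.map_jacobiTrudi {K L : Type*} [CommRing K] [CommRing L] (F : K →+* L) (f : K⟦X⟧)
    (lam : Partition') : F (jacobiTrudi f lam) = jacobiTrudi (PowerSeries.map F f) lam := by
  unfold jacobiTrudi
  rw [RingHom.map_det]
  congr 1
  ext i j
  simp [apply_ite F]

theorem PowerSeries.derivative_map {K L : Type*} [CommRing K] [CommRing L] (F : K →+* L)
    (f : K⟦X⟧) : d⁄dX L (PowerSeries.map F f) = PowerSeries.map F (d⁄dX K f) := by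
  ext n
  simp [coeff_derivative]

theorem RSummable.mul_conj {R : ℝ} (hR : 1 < R) {t : ℕ → ℂ} (ht : RSummable R t) :
    RSummable R fun n => (n + 1) * (t n * (starRingEnd ℂ) (t n)) := by
  obtain ⟨A, hA⟩ := ht.tendsto_atTop_zero.bddAbove_range
  have hR1 : |R⁻¹| < 1 := by
    rw [abs_of_pos (by positivity)]
    exact inv_lt_one_of_one_lt₀ hR
  obtain ⟨B, hB⟩ := ((tendsto_self_mul_const_pow_of_abs_lt_one hR1).comp
    (Filter.tendsto_add_atTop_nat 1)).bddAbove_range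
  refine Summable.of_nonneg_of_le (fun n => by positivity) (fun n => ?_)
    ((ht.mul_left A).mul_left B)
  have h1 : ‖t n‖ * R ^ (n + 1) ≤ A := hA ⟨n, rfl⟩
  have h2 : ((n + 1 : ℕ) : ℝ) * R⁻¹ ^ (n + 1) ≤ B := hB ⟨n, rfl⟩
  have h3 : ‖((n : ℂ) + 1) * (t n * (starRingEnd ℂ) (t n))‖ * R ^ (n + 1) =
      (((n + 1 : ℕ) : ℝ) * R⁻¹ ^ (n + 1)) *
        ((‖t n‖ * R ^ (n + 1)) * (‖t n‖ * R ^ (n + 1))) := by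
    have h4 : ‖(n : ℂ) + 1‖ = ((n + 1 : ℕ) : ℝ) := by
      rw [← Nat.cast_succ, Complex.norm_natCast]
    rw [norm_mul, norm_mul, h4, RCLike.norm_conj, inv_pow]
    field_simp
  have hB0 : 0 ≤ B := le_trans (by positivity) h2
  rw [h3]
  gcongr

theorem RSummable.hasSum_norm_schurPoly_sq {R : ℝ} (hR : 1 < R) {t : ℕ → ℂ}
    (ht : RSummable R t) (n : ℕ) :
    HasSum (fun lam : {lam : Partition' // lam.size = n} => ((‖schurPoly t lam.1‖ ^ 2 : ℝ) : ℂ))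
      (coeff n (hcoefSeries fun n => (n + 1) * (t n * (starRingEnd ℂ) (t n)))) := by
  have hu := ht.mul_conj hR
  have h := hasSum_jacobiTrudi_mul (f := hcoefSeries t)
    (g := PowerSeries.map (starRingEnd ℂ) (hcoefSeries t))
    (e := hcoefSeries fun n => (n + 1) * (t n * (starRingEnd ℂ) (t n)))
    (F := d⁄dX ℂ (expSeries t)) (G := PowerSeries.map (starRingEnd ℂ) (d⁄dX ℂ (expSeries t)))
    (ht.derivative_hcoefSeries hR)
    (by rw [PowerSeries.derivative_map, ht.derivative_hcoefSeries hR, map_mul])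
    (by
      rw [hu.derivative_hcoefSeries hR]
      congr 1
      ext m
      simp only [coeff_derivative, expSeries, coeff_mk, coeff_map, map_mul, map_add, map_one,
        map_natCast]
      ring)
    (ht.constantCoeff_hcoefSeries hR)
    (by
      rw [← coeff_zero_eq_constantCoeff_apply, coeff_map, coeff_zero_eq_constantCoeff_apply,
        ht.constantCoeff_hcoefSeries hR, map_one])
    (hu.constantCoeff_hcoefSeries hR) n
  have heq : (fun lam : {lam : Partition' // lam.size = n} =>
      ((‖schurPoly t lam.1‖ ^ 2 : ℝ) : ℂ)) = fun lam =>
        jacobiTrudi (PowerSeries.map (starRingEnd ℂ) (hcoefSeries t)) lam.1 *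
          jacobiTrudi (hcoefSeries t) lam.1 := by
    ext lam
    rw [← RingHom.map_jacobiTrudi, ← schurPoly_eq_jacobiTrudi, Complex.conj_mul']
    push_cast
    rfl
  rw [heq]
  exact h

end Analytic

/-- specialized Cauchy identity:
`∑_λ |s_λ(t)|² = exp (∑_{n ≥ 1} n |t_n|²)`, the family being summable. -/
theorem cauchy_identity_schur (R : ℝ) (hR : 1 < R) (t : ℕ → ℂ)
    (ht : RSummable R t) :
    (Summable fun lam : Partition' => ‖schurPoly t lam‖ ^ 2) ∧
      ∑' lam : Partition', ‖schurPoly t lam‖ ^ 2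
        = Real.exp (∑' n : ℕ, (n + 1 : ℝ) * ‖t n‖ ^ 2) := by
  have hu := ht.mul_conj hR
  have hn (n : ℕ) : Summable fun lam : {lam : Partition' // lam.size = n} =>
      ‖schurPoly t lam.1‖ ^ 2 :=
    Complex.summable_ofReal.mp (ht.hasSum_norm_schurPoly_sq hR n).summable
  have hc : HasSum (fun n => ∑' lam : {lam : Partition' // lam.size = n}, ‖schurPoly t lam.1‖ ^ 2)
      (Real.exp (∑' n : ℕ, (n + 1 : ℝ) * ‖t n‖ ^ 2)) := by
    rw [← Complex.hasSum_ofReal]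
    convert hu.hasSum_coeff_hcoefSeries hR using 1
    · ext n
      rw [Complex.ofReal_tsum, (ht.hasSum_norm_schurPoly_sq hR n).tsum_eq]
    · rw [Complex.ofReal_exp, Complex.ofReal_tsum]
      congr 2
      ext n
      rw [Complex.mul_conj']
      push_cast
      rfl
  have hs : Summable fun x : (Σ n, {lam : Partition' // lam.size = n}) =>
      ‖schurPoly t x.2.1‖ ^ 2 :=
    (summable_sigma_of_nonneg fun x => by positivity).mpr ⟨hn, hc.summable⟩
  have he : (fun x : (Σ n, {lam : Partition' // lam.size = n}) => ‖schurPoly t x.2.1‖ ^ 2) =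
      (fun lam => ‖schurPoly t lam‖ ^ 2) ∘ Equiv.sigmaFiberEquiv Partition'.size := rfl
  refine ⟨(Equiv.sigmaFiberEquiv Partition'.size).summable_iff.mp (he ▸ hs), ?_⟩
  rw [← hc.tsum_eq, ← hs.tsum_sigma' hn]
  exact ((Equiv.sigmaFiberEquiv Partition'.size).tsum_eq fun lam => ‖schurPoly t lam‖ ^ 2).symm

end
end

section
/- Let R > 1, let t, t' be R-summable sequences of complex numbers, and let σ : ℤ' → [0,1] satisfy Σ_{k∈ℤ', k<0} σ(k) < ∞. Then for all x, y ∈ ℤ' the series defining the kernel K_{t,t',σ}(x,y) converges absolutely: Σ_{k∈ℤ'} σ(k) |J_{x+k}(t,t')| |J_{−y−k}(−t,−t')| < ∞. -/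
open scoped BigOperators

noncomputable section

theorem RSummable.summable_norm {R : ℝ} (hR : 1 ≤ R) {t : ℕ → ℂ} (ht : RSummable R t) :
    Summable fun n => ‖t n‖ :=
  Summable.of_nonneg_of_le (fun _ => norm_nonneg _)
    (fun _ => le_mul_of_one_le_right (norm_nonneg _) (one_le_pow₀ hR)) ht

/-- `J` restricted to the unit circle is continuous. -/
theorem continuous_Jfun_exp {t t' : ℕ → ℂ} (ht : Summable fun n => ‖t n‖)
    (ht' : Summable fun n => ‖t' n‖) :
    Continuous fun θ : ℝ => Jfun (Complex.exp (θ * Complex.I)) t t' := by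
  unfold Jfun
  refine Complex.continuous_exp.comp (continuous_tsum (fun _ => ?_) (ht.add ht') fun _ _ => ?_)
  · simp_rw [← Complex.exp_neg]
    fun_prop
  · refine (norm_sub_le _ _).trans_eq ?_
    simp [Complex.norm_exp_ofReal_mul_I]

theorem Jcoef_eq_fourierCoeffOn (t t' : ℕ → ℂ) (k : ℤ) :
    Jcoef t t' k = fourierCoeffOn Real.two_pi_pos
      (fun θ : ℝ => Jfun (Complex.exp (θ * Complex.I)) t t') k := by
  rw [fourierCoeffOn_eq_integral, Jcoef, Complex.real_smul]
  congr 1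
  · simp
  · refine intervalIntegral.integral_congr fun θ _ => ?_
    have hπ : (Real.pi : ℂ) ≠ 0 := Complex.ofReal_ne_zero.mpr Real.pi_ne_zero
    simp only [fourier_coe_apply, smul_eq_mul]
    rw [mul_comm]
    congr 2
    push_cast
    field_simp
    simp [mul_assoc]

/-- Bessel's inequality for the Laurent coefficients of `J`. -/
theorem summable_sq_norm_Jcoef {t t' : ℕ → ℂ} (ht : Summable fun n => ‖t n‖)
    (ht' : Summable fun n => ‖t' n‖) :
    Summable fun k : ℤ => ‖Jcoef t t' k‖ ^ 2 := by
  simp_rw [Jcoef_eq_fourierCoeffOn]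
  have hJ := continuous_Jfun_exp ht ht'
  refine (hasSum_sq_fourierCoeffOn Real.two_pi_pos ?_).summable
  rw [MeasureTheory.memLp_two_iff_integrable_sq_norm hJ.aestronglyMeasurable]
  exact ((hJ.norm.pow 2).integrableOn_Icc (a := 0) (b := 2 * Real.pi)).mono_set
    Set.Ioc_subset_Icc_self

/-- absolute convergence of the series defining the kernel
`K_{t,t',σ}(x,y)`, for all half-integers `x = a + 1/2`, `y = b + 1/2`. -/
theorem kernel_series_abs_conv (R : ℝ) (hR : 1 < R) (t t' : ℕ → ℂ)
    (ht : RSummable R t) (ht' : RSummable R t')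
    (σ : ℤ → ℝ) (hσ01 : ∀ k, σ k ∈ Set.Icc (0:ℝ) 1)
    (hσsum : Summable fun k : {k : ℤ // k < 0} => σ k)
    (a b : ℤ) :
    Summable fun c : ℤ =>
      σ c * ‖Jcoef t t' (a + c + 1)‖ * ‖Jcoef (-t) (-t') (-(b + c + 1))‖ := by
  have hs := ht.summable_norm hR.le
  have hs' := ht'.summable_norm hR.le
  have h₁ : Summable fun c : ℤ => ‖Jcoef t t' (a + c + 1)‖ ^ 2 :=
    (summable_sq_norm_Jcoef hs hs').comp_injective
      (i := fun c : ℤ => a + c + 1) fun c d h => by simpa using h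
  have h₂ : Summable fun c : ℤ => ‖Jcoef (-t) (-t') (-(b + c + 1))‖ ^ 2 :=
    (summable_sq_norm_Jcoef (t := -t) (t' := -t') (by simpa using hs)
      (by simpa using hs')).comp_injective
      (i := fun c : ℤ => -(b + c + 1)) fun c d h => by simpa using h
  refine Summable.of_nonneg_of_le (fun c => ?_) (fun c => ?_) (h₁.add h₂)
  · have := (hσ01 c).1
    positivity
  · set u := ‖Jcoef t t' (a + c + 1)‖
    set v := ‖Jcoef (-t) (-t') (-(b + c + 1))‖
    have huv : 0 ≤ u * v := by positivity
    have h : σ c * (u * v) ≤ u * v := mul_le_of_le_one_left huv (hσ01 c).2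
    linarith [two_mul_le_add_sq u v]

end
end

section
/- Let R > 1, let t, t' be R-summable sequences of complex numbers, let σ : ℤ' → [0,1] satisfy Σ_{k∈ℤ', k<0} σ(k) < ∞, and let n ∈ ℤ. Then both Hilbert–Schmidt sums in the factorization of the restricted kernel are finite: Σ_{x∈ℤ', x>n} Σ_{k∈ℤ'} σ(k) |J_{x+k}(t,t')|² < ∞ and Σ_{y∈ℤ', y>n} Σ_{k∈ℤ'} σ(k) |J_{−k−y}(−t,−t')|² < ∞. (These two facts express that the restriction of K_{t,t',σ} to ℓ²(ℤ' ∩ (n,∞)) is a product of two Hilbert–Schmidt operators, hence trace class.) -/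
open scoped BigOperators

noncomputable section

/-- On the annulus `1/R < |z| < R` each term of the series in the exponent of `J` is dominated by
a term of a convergent series that does not depend on `z`. -/
lemma norm_exponent_term_le {R : ℝ} (hR : 0 < R) (t t' : ℕ → ℂ) {z : ℂ}
    (h1 : R⁻¹ < ‖z‖) (h2 : ‖z‖ < R) (n : ℕ) :
    ‖t n * z ^ (n + 1) - t' n * z⁻¹ ^ (n + 1)‖ ≤
      ‖t n‖ * R ^ (n + 1) + ‖t' n‖ * R ^ (n + 1) := by
  have h3 : ‖z‖⁻¹ ≤ R := (inv_lt_of_inv_lt₀ hR h1).le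
  calc _ ≤ ‖t n * z ^ (n + 1)‖ + ‖t' n * z⁻¹ ^ (n + 1)‖ := norm_sub_le _ _
    _ = ‖t n‖ * ‖z‖ ^ (n + 1) + ‖t' n‖ * ‖z‖⁻¹ ^ (n + 1) := by simp
    _ ≤ _ := by gcongr

lemma differentiableAt_Jfun {R : ℝ} (hR : 0 < R) {t t' : ℕ → ℂ}
    (ht : RSummable R t) (ht' : RSummable R t') {z : ℂ} (h1 : R⁻¹ < ‖z‖) (h2 : ‖z‖ < R) :
    DifferentiableAt ℂ (fun w => Jfun w t t') z := by
  have hU : IsOpen {w : ℂ | R⁻¹ < ‖w‖ ∧ ‖w‖ < R} :=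
    (isOpen_lt continuous_const continuous_norm).inter
      (isOpen_lt continuous_norm continuous_const)
  have hd : DifferentiableOn ℂ
      (fun w : ℂ => ∑' n : ℕ, (t n * w ^ (n + 1) - t' n * w⁻¹ ^ (n + 1)))
      {w : ℂ | R⁻¹ < ‖w‖ ∧ ‖w‖ < R} := by
    refine Complex.differentiableOn_tsum_of_summable_norm (ht.add ht') (fun n w hw => ?_) hU
      (fun n w hw => norm_exponent_term_le hR t t' hw.1 hw.2 n)
    have hw0 : w ≠ 0 := norm_pos_iff.1 ((inv_pos.2 hR).trans hw.1)
    exact ((differentiableAt_id.pow _).const_mul _ |>.sub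
      (((differentiableAt_inv hw0).pow _).const_mul _)).differentiableWithinAt
  exact (hd.differentiableAt (hU.mem_nhds ⟨h1, h2⟩)).cexp

lemma norm_Jfun_le {R : ℝ} (hR : 0 < R) {t t' : ℕ → ℂ}
    (ht : RSummable R t) (ht' : RSummable R t') {z : ℂ} (h1 : R⁻¹ < ‖z‖) (h2 : ‖z‖ < R) :
    ‖Jfun z t t'‖ ≤ Real.exp (∑' n : ℕ, (‖t n‖ * R ^ (n + 1) + ‖t' n‖ * R ^ (n + 1))) :=
  (Complex.norm_exp_le_exp_norm _).trans <| Real.exp_le_exp.2 <|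
    tsum_of_norm_bounded (ht.add ht').hasSum fun n => norm_exponent_term_le hR t t' h1 h2 n

lemma Jcoef_eq_circleIntegral (t t' : ℕ → ℂ) (k : ℤ) :
    Jcoef t t' k = (2 * Real.pi * Complex.I : ℂ)⁻¹ *
      ∮ z in C(0, 1), (z - 0)⁻¹ • (Jfun z t t' * z ^ (-k)) := by
  have hcircle : (∮ z in C(0, 1), (z - 0)⁻¹ • (Jfun z t t' * z ^ (-k))) =
      Complex.I * ∫ θ in (0 : ℝ)..(2 * Real.pi),
        Jfun (Complex.exp (θ * Complex.I)) t t' * Complex.exp (-(k : ℂ) * θ * Complex.I) := by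
    rw [circleIntegral, ← intervalIntegral.integral_const_mul]
    refine intervalIntegral.integral_congr fun θ _ => ?_
    have hk : Complex.exp (-(k : ℂ) * θ * Complex.I) = Complex.exp (θ * Complex.I) ^ (-k) := by
      rw [← Complex.exp_int_mul]
      push_cast
      ring_nf
    have h0 : Complex.exp (θ * Complex.I) ≠ 0 := Complex.exp_ne_zero _
    simp only [deriv_circleMap, circleMap, Complex.ofReal_one, one_mul, zero_add, sub_zero,
      smul_eq_mul, hk]
    field_simp
  rw [hcircle, Jcoef, mul_inv _ Complex.I, mul_assoc, inv_mul_cancel_left₀ Complex.I_ne_zero]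

lemma circleIntegral_Jfun_eq_of_le {R : ℝ} (hR : 0 < R) {t t' : ℕ → ℂ}
    (ht : RSummable R t) (ht' : RSummable R t') (k : ℤ) {r s : ℝ}
    (hr : R⁻¹ < r) (hrs : r ≤ s) (hs : s < R) :
    (∮ z in C(0, s), (z - 0)⁻¹ • (Jfun z t t' * z ^ (-k))) =
      ∮ z in C(0, r), (z - 0)⁻¹ • (Jfun z t t' * z ^ (-k)) := by
  have hr0 : 0 < r := (inv_pos.2 hR).trans hr
  have hd : ∀ z : ℂ, r ≤ ‖z‖ → ‖z‖ ≤ s →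
      DifferentiableAt ℂ (fun z => Jfun z t t' * z ^ (-k)) z := fun z h1 h2 =>
    (differentiableAt_Jfun hR ht ht' (hr.trans_le h1) (h2.trans_lt hs)).mul
      (differentiableAt_zpow.2 (Or.inl (norm_pos_iff.1 (hr0.trans_le h1))))
  refine Complex.circleIntegral_sub_center_inv_smul_eq_of_differentiable_on_annulus_off_countable
    hr0 hrs Set.countable_empty (fun z hz => ?_) (fun z hz => ?_)
  · simp only [Set.mem_sdiff, Metric.mem_closedBall, Metric.mem_ball, dist_zero_right,
      not_lt] at hz
    exact (hd z hz.2 hz.1).continuousAt.continuousWithinAt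
  · simp only [Set.mem_sdiff, Metric.mem_closedBall, Metric.mem_ball, dist_zero_right,
      not_le, Set.mem_empty_iff_false, not_false_eq_true, and_true] at hz
    exact hd z hz.2.le hz.1.le

/-- Cauchy's estimate for the Laurent coefficients of `J`. -/
lemma norm_Jcoef_le {R : ℝ} (hR : 1 < R) {t t' : ℕ → ℂ}
    (ht : RSummable R t) (ht' : RSummable R t') (k : ℤ) {r : ℝ} (h1 : R⁻¹ < r) (h2 : r < R) :
    ‖Jcoef t t' k‖ ≤
      Real.exp (∑' n : ℕ, (‖t n‖ * R ^ (n + 1) + ‖t' n‖ * R ^ (n + 1))) * r ^ (-k) := by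
  have hR0 : 0 < R := one_pos.trans hR
  have hr0 : 0 < r := (inv_pos.2 hR0).trans h1
  have hshift : (∮ z in C(0, 1), (z - 0)⁻¹ • (Jfun z t t' * z ^ (-k))) =
      ∮ z in C(0, r), (z - 0)⁻¹ • (Jfun z t t' * z ^ (-k)) := by
    rcases le_total r 1 with h | h
    · exact circleIntegral_Jfun_eq_of_le hR0 ht ht' k h1 h hR
    · exact (circleIntegral_Jfun_eq_of_le hR0 ht ht' k (inv_lt_one_of_one_lt₀ hR) h h2).symm
  rw [Jcoef_eq_circleIntegral, hshift, ← smul_eq_mul]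
  refine (circleIntegral.norm_two_pi_i_inv_smul_integral_le_of_norm_le_const
    (C := r⁻¹ * (Real.exp (∑' n : ℕ, (‖t n‖ * R ^ (n + 1) + ‖t' n‖ * R ^ (n + 1))) * r ^ (-k)))
    hr0.le fun z hz => ?_).trans_eq (mul_inv_cancel_left₀ hr0.ne' _)
  have hz' : ‖z‖ = r := by simpa using hz
  rw [norm_smul, norm_mul, norm_inv, norm_zpow, sub_zero, hz']
  gcongr
  exact norm_Jfun_le hR0 ht ht' (hz' ▸ h1) (hz' ▸ h2)

lemma exists_norm_Jcoef_sq_le {R : ℝ} (hR : 1 < R) {t t' : ℕ → ℂ}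
    (ht : RSummable R t) (ht' : RSummable R t') :
    ∃ C q : ℝ, 0 < q ∧ q < 1 ∧ ∀ k : ℤ, ‖Jcoef t t' k‖ ^ 2 ≤ C * q ^ k.natAbs := by
  obtain ⟨r, hr1, hrR⟩ := exists_between hR
  have hr0 : 0 < r := one_pos.trans hr1
  refine ⟨Real.exp (∑' n : ℕ, (‖t n‖ * R ^ (n + 1) + ‖t' n‖ * R ^ (n + 1))) ^ 2, r⁻¹ ^ 2,
    by positivity, pow_lt_one₀ (inv_pos.2 hr0).le (inv_lt_one_of_one_lt₀ hr1) two_ne_zero,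
    fun k => ?_⟩
  rw [← pow_mul, mul_comm 2, pow_mul, ← mul_pow]
  refine pow_le_pow_left₀ (norm_nonneg _) ?_ 2
  rcases le_total 0 k with hk | hk
  · have h := norm_Jcoef_le hR ht ht' k ((inv_lt_one_of_one_lt₀ hR).trans hr1) hrR
    lift k to ℕ using hk
    simpa using h
  · have h := norm_Jcoef_le hR ht ht' k (inv_strictAnti₀ hr0 hrR)
      ((inv_lt_one_of_one_lt₀ hr1).trans hR)
    obtain ⟨m, rfl⟩ := Int.exists_eq_neg_ofNat hk
    simpa using h

lemma summable_pow_natAbs {q : ℝ} (hq0 : 0 < q) (hq1 : q < 1) :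
    Summable fun k : ℤ => q ^ k.natAbs :=
  Summable.of_nat_of_neg (by simpa using summable_geometric_of_lt_one hq0.le hq1)
    (by simpa using summable_geometric_of_lt_one hq0.le hq1)

lemma summable_weight_mul_of_geometric_decay {σ : ℤ → ℝ}
    (hσ01 : ∀ k, σ k ∈ Set.Icc (0 : ℝ) 1) (hσsum : Summable fun k : {k : ℤ // k < 0} => σ k)
    (n : ℤ) {g : ℤ → ℝ} (hg0 : ∀ k, 0 ≤ g k) {C q : ℝ} (hq0 : 0 < q) (hq1 : q < 1)
    (hg : ∀ k, g k ≤ C * q ^ k.natAbs) :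
    Summable fun p : {a : ℤ // n ≤ a} × ℤ => σ p.2 * g ((p.1 : ℤ) + p.2 + 1) := by
  have hC : 0 ≤ C := by simpa using (hg0 0).trans (hg 0)
  have hq := summable_pow_natAbs hq0 hq1
  have hσ : Summable (Set.indicator {k : ℤ | k < 0} σ) := summable_subtype_iff_indicator.1 hσsum
  have hσ0 : ∀ k, 0 ≤ Set.indicator {k : ℤ | k < 0} σ k :=
    fun k => Set.indicator_nonneg (fun k _ => (hσ01 k).1) k
  have hneg : Summable fun p : {a : ℤ // n ≤ a} × ℤ =>
      Set.indicator {k : ℤ | k < 0} σ p.2 * g ((p.1 : ℤ) + p.2 + 1) := by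
    have hinj : Function.Injective
        fun p : {a : ℤ // n ≤ a} × ℤ => (p.2, (p.1 : ℤ) + p.2 + 1) := by
      rintro ⟨⟨a, ha⟩, c⟩ ⟨⟨b, hb⟩, d⟩ h
      obtain ⟨rfl, h2⟩ := Prod.mk.inj h
      exact Prod.ext (Subtype.ext (by simpa using h2)) rfl
    have hprod := hσ.mul_of_nonneg (Summable.of_nonneg_of_le hg0 hg (hq.mul_left C)) hσ0 hg0
    exact (hprod.comp_injective hinj).congr fun _ => rfl
  have hpos : Summable fun p : {a : ℤ // n ≤ a} × ℤ =>
      C * q ^ (n + 1) * (q ^ ((p.1 : ℤ) - n).natAbs * q ^ p.2.natAbs) := by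
    have hinj : Function.Injective fun p : {a : ℤ // n ≤ a} × ℤ => ((p.1 : ℤ) - n, p.2) := by
      rintro ⟨⟨a, ha⟩, c⟩ ⟨⟨b, hb⟩, d⟩ h
      obtain ⟨h1, rfl⟩ := Prod.mk.inj h
      exact Prod.ext (Subtype.ext (by simpa using h1)) rfl
    have hprod := hq.mul_of_nonneg hq (fun _ => pow_nonneg hq0.le _) fun _ => pow_nonneg hq0.le _
    exact ((hprod.comp_injective hinj).congr fun _ => rfl).mul_left _
  refine Summable.of_nonneg_of_le (fun p => mul_nonneg (hσ01 _).1 (hg0 _)) ?_ (hneg.add hpos)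
  rintro ⟨⟨a, ha⟩, c⟩
  rcases lt_or_ge c 0 with hc | hc
  · have hσc : Set.indicator {k : ℤ | k < 0} σ c = σ c :=
      Set.indicator_of_mem (s := {k : ℤ | k < 0}) hc σ
    simp only [hσc]
    exact (le_add_iff_nonneg_right _).2 (by positivity)
  · refine le_add_of_nonneg_of_le (mul_nonneg (hσ0 _) (hg0 _)) ?_
    calc σ c * g (a + c + 1) ≤ 1 * g (a + c + 1) :=
          mul_le_mul_of_nonneg_right (hσ01 c).2 (hg0 _)
      _ ≤ C * q ^ (a + c + 1).natAbs := by simpa using hg (a + c + 1)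
      _ ≤ C * q ^ (a + c + 1) := by
          rw [← zpow_natCast]
          exact mul_le_mul_of_nonneg_left
            (zpow_le_zpow_right_of_le_one₀ hq0 hq1.le (by omega)) hC
      _ = C * q ^ (n + 1) * (q ^ (a - n).natAbs * q ^ c.natAbs) := by
          rw [← zpow_natCast, ← zpow_natCast, Int.natAbs_of_nonneg (sub_nonneg.2 ha),
            Int.natAbs_of_nonneg hc, mul_assoc, ← zpow_add₀ hq0.ne', ← zpow_add₀ hq0.ne']
          ring_nf

/-- the two Hilbert–Schmidt sums are finite:
`∑_{x ∈ ℤ', x > n} ∑_{k ∈ ℤ'} σ(k) |J_{x+k}(t,t')|² < ∞` and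
`∑_{y ∈ ℤ', y > n} ∑_{k ∈ ℤ'} σ(k) |J_{-k-y}(-t,-t')|² < ∞`
(half-integers `> n` are encoded by integers `a` with `n ≤ a`). -/
theorem hilbert_schmidt_sums (R : ℝ) (hR : 1 < R) (t t' : ℕ → ℂ)
    (ht : RSummable R t) (ht' : RSummable R t')
    (σ : ℤ → ℝ) (hσ01 : ∀ k, σ k ∈ Set.Icc (0:ℝ) 1)
    (hσsum : Summable fun k : {k : ℤ // k < 0} => σ k)
    (n : ℤ) :
    (Summable fun p : {a : ℤ // n ≤ a} × ℤ =>
        σ p.2 * ‖Jcoef t t' ((p.1 : ℤ) + p.2 + 1)‖ ^ 2) ∧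
      Summable fun p : {a : ℤ // n ≤ a} × ℤ =>
        σ p.2 * ‖Jcoef (-t) (-t') (-((p.1 : ℤ) + p.2 + 1))‖ ^ 2 := by
  have hneg : ∀ {s : ℕ → ℂ}, RSummable R s → RSummable R (-s) := fun h => by
    simpa [RSummable] using h
  obtain ⟨C, q, hq0, hq1, h⟩ := exists_norm_Jcoef_sq_le hR ht ht'
  obtain ⟨C', q', hq0', hq1', h'⟩ := exists_norm_Jcoef_sq_le hR (hneg ht) (hneg ht')
  exact ⟨summable_weight_mul_of_geometric_decay hσ01 hσsum n
      (g := fun k => ‖Jcoef t t' k‖ ^ 2) (fun _ => sq_nonneg _) hq0 hq1 h,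
    summable_weight_mul_of_geometric_decay hσ01 hσsum n
      (g := fun k => ‖Jcoef (-t) (-t') (-k)‖ ^ 2) (fun _ => sq_nonneg _) hq0' hq1'
      fun k => by simpa using h' (-k)⟩

end
end
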